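/- arXiv:0910.5453 — 3 statements merged into one kernel-verified Lean document; each statement's English description precedes it below -/
import Mathlib

section
/- Define the flat polynomials t_2 = u_2, t_5 = u_5, t_6 = u_6 - 15 u_2^3, t_8 = (3/16)(u_8 - (7/2) u_6 u_2 + (385/12) u_2^4), t_9 = (1/7)(u_9 - (42/5) u_5 u_2^2), and t_12 = u_12 - (209/16) u_8 u_2^2 - (77/576) u_6^2 + (2959/96) u_6 u_2^3 - (121/120) u_5^2 u_2 - (6633/32) u_2^6. Then for every pair of degrees α, β ∈ {2,5,6,8,9,12} there exist a rational constant c_{αβ} and a polynomial Q_{αβ} with rational coefficients in five indeterminates such that ⟨dt_α, dt_β⟩* = c_{αβ} · t_12 + Q_{αβ}(t_2, t_5, t_6, t_8, t_9) as polynomials in y; moreover c_{αβ} = 0 whenever α + β ≠ 14, and c_{αβ} = 24 whenever α + β = 14. -/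
open MvPolynomial

noncomputable section

/-- `S6 = x₁ + ⋯ + x₆` inside the eight variables `x₁,…,x₈`. -/
def S6 : MvPolynomial (Fin 8) ℚ := X 0 + X 1 + X 2 + X 3 + X 4 + X 5

/-- The `E₆`-invariant polynomial `U_m`. -/
def U (m : ℕ) : MvPolynomial (Fin 8) ℚ :=
  (∑ i ∈ Finset.univ.filter (fun i : Fin 8 => i.val < 6),
      ((C (1/2 : ℚ) * (X 6 - X 7) - X i + C (1/6 : ℚ) * S6) ^ m +
        (-(C (1/2 : ℚ) * (X 6 - X 7)) - X i + C (1/6 : ℚ) * S6) ^ m)) +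
    ∑ p ∈ Finset.univ.filter (fun p : Fin 8 × Fin 8 => p.1.val < p.2.val ∧ p.2.val < 6),
      (X p.1 + X p.2 - C (1/3 : ℚ) * S6) ^ m

/-- Restriction to the subspace `S6 = 0`, `x₇ + x₈ = 0`:
substitute `x₆ = -(x₁+⋯+x₅)` and `x₈ = -x₇`, with the remaining
variables `y = (x₁,…,x₅,x₇)`. -/
def subE6 : Fin 8 → MvPolynomial (Fin 6) ℚ :=
  ![X 0, X 1, X 2, X 3, X 4, -(X 0 + X 1 + X 2 + X 3 + X 4), X 5, -X 5]

/-- The basic invariants `u_m` in the six variables `y`, with `u₂ = U₂/12`. -/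
def u (m : ℕ) : MvPolynomial (Fin 6) ℚ :=
  if m = 2 then C (1/12 : ℚ) * aeval subE6 (U 2) else aeval subE6 (U m)

/-- The symmetric matrix `G` determined by `u₂(y) = ∑ᵢⱼ Gᵢⱼ yᵢ yⱼ`. -/
def GE6 : Matrix (Fin 6) (Fin 6) ℚ := fun i j =>
  if i = j then coeff (Finsupp.single i 2) (u 2)
  else (1/2) * coeff (Finsupp.single i 1 + Finsupp.single j 1) (u 2)

/-- The pairing `⟨dp, dq⟩* = ∑ᵢⱼ (∂p/∂yᵢ) (G⁻¹)ᵢⱼ (∂q/∂yⱼ)`. -/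
def pairE6 (p q : MvPolynomial (Fin 6) ℚ) : MvPolynomial (Fin 6) ℚ :=
  ∑ i : Fin 6, ∑ j : Fin 6, C (GE6⁻¹ i j) * pderiv i p * pderiv j q

/-- The flat polynomials `t₂, t₅, t₆, t₈, t₉, t₁₂` for `E₆`. -/
def tE6 : Fin 6 → MvPolynomial (Fin 6) ℚ :=
  ![u 2,
    u 5,
    u 6 - C (15 : ℚ) * u 2 ^ 3,
    C (3/16 : ℚ) * (u 8 - C (7/2 : ℚ) * u 6 * u 2 + C (385/12 : ℚ) * u 2 ^ 4),
    C (1/7 : ℚ) * (u 9 - C (42/5 : ℚ) * u 5 * u 2 ^ 2),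
    u 12 - C (209/16 : ℚ) * u 8 * u 2 ^ 2 - C (77/576 : ℚ) * u 6 ^ 2 +
      C (2959/96 : ℚ) * u 6 * u 2 ^ 3 - C (121/120 : ℚ) * u 5 ^ 2 * u 2 -
      C (6633/32 : ℚ) * u 2 ^ 6]

/-- The degrees `2, 5, 6, 8, 9, 12` of the basic invariants of `E₆`. -/
def degE6 : Fin 6 → ℕ := ![2, 5, 6, 8, 9, 12]

/-- The duality `d ↦ 14 - d` on the degrees of `E₆` (indexwise, a reversal). -/
def dualE6 : Fin 6 → Fin 6 := ![5, 4, 3, 2, 1, 0]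

/-- A monomial in six variables. -/
def mo (r : ℚ) (a b c d e f : ℕ) : MvPolynomial (Fin 6) ℚ :=
  C r * X 0 ^ a * X 1 ^ b * X 2 ^ c * X 3 ^ d * X 4 ^ e * X 5 ^ f

/-- A monomial in five variables. -/
def mq (r : ℚ) (a b c d e : ℕ) : MvPolynomial (Fin 5) ℚ :=
  C r * X 0 ^ a * X 1 ^ b * X 2 ^ c * X 3 ^ d * X 4 ^ e

theorem eval_mo (v : Fin 6 → ℚ) (r : ℚ) (a b c d e f : ℕ) : eval v (mo r a b c d e f) =
    r * v 0 ^ a * v 1 ^ b * v 2 ^ c * v 3 ^ d * v 4 ^ e * v 5 ^ f := by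
  simp only [mo, map_mul, map_pow, eval_C, eval_X]

theorem eval_mq (v : Fin 5 → ℚ) (r : ℚ) (a b c d e : ℕ) : eval v (mq r a b c d e) =
    r * v 0 ^ a * v 1 ^ b * v 2 ^ c * v 3 ^ d * v 4 ^ e := by
  simp only [mq, map_mul, map_pow, eval_C, eval_X]

theorem pd0 (r : ℚ) (a b c d e f : ℕ) :
    pderiv 0 (mo r a b c d e f) = mo (r * a) (a - 1) b c d e f := by
  simp [mo, Derivation.leibniz, Derivation.leibniz_pow, pderiv_X]
  ring

theorem pd1 (r : ℚ) (a b c d e f : ℕ) :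
    pderiv 1 (mo r a b c d e f) = mo (r * b) a (b - 1) c d e f := by
  simp [mo, Derivation.leibniz, Derivation.leibniz_pow, pderiv_X]
  ring

theorem pd2 (r : ℚ) (a b c d e f : ℕ) :
    pderiv 2 (mo r a b c d e f) = mo (r * c) a b (c - 1) d e f := by
  simp [mo, Derivation.leibniz, Derivation.leibniz_pow, pderiv_X]
  ring

theorem pd3 (r : ℚ) (a b c d e f : ℕ) :
    pderiv 3 (mo r a b c d e f) = mo (r * d) a b c (d - 1) e f := by
  simp [mo, Derivation.leibniz, Derivation.leibniz_pow, pderiv_X]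
  ring

theorem pd4 (r : ℚ) (a b c d e f : ℕ) :
    pderiv 4 (mo r a b c d e f) = mo (r * e) a b c d (e - 1) f := by
  simp [mo, Derivation.leibniz, Derivation.leibniz_pow, pderiv_X]
  ring

theorem pd5 (r : ℚ) (a b c d e f : ℕ) :
    pderiv 5 (mo r a b c d e f) = mo (r * f) a b c d e (f - 1) := by
  simp [mo, Derivation.leibniz, Derivation.leibniz_pow, pderiv_X]
  ring

/-- The six coordinates `x₁, …, x₆` restricted to the subspace. -/
def xs : Fin 6 → MvPolynomial (Fin 6) ℚ :=
  ![X 0, X 1, X 2, X 3, X 4, -(X 0 + X 1 + X 2 + X 3 + X 4)]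

/-- Power sums. -/
def pw (k : ℕ) : MvPolynomial (Fin 6) ℚ := ∑ i, xs i ^ k

/-- First set of generators `w = x₇², p₂, …, p₆`. -/
def gg : Fin 6 → MvPolynomial (Fin 6) ℚ := ![X 5 ^ 2, pw 2, pw 3, pw 4, pw 5, pw 6]

theorem eval_aeval' {n : ℕ} (v : Fin 6 → ℚ) (f : Fin n → MvPolynomial (Fin 6) ℚ)
    (p : MvPolynomial (Fin n) ℚ) : eval v (aeval f p) = eval (fun i => eval v (f i)) p := by
  induction p using MvPolynomial.induction_on with
  | C a => simp only [algHom_C, algebraMap_eq, eval_C]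
  | add p q hp hq => simp only [map_add, hp, hq]
  | mul_X p n hp => simp only [map_mul, hp, aeval_X, eval_X]

theorem eval_U (v : Fin 6 → ℚ) (m : ℕ) (a b c d e f z : ℚ) (ha : v 0 = a) (hb : v 1 = b)
    (hc : v 2 = c) (hd : v 3 = d) (he : v 4 = e) (hz : v 5 = z) (hf : a + b + c + d + e + f = 0) :
    eval v (aeval subE6 (U m)) =
      ((z - a) ^ m + (-z - a) ^ m + ((z - b) ^ m + (-z - b) ^ m) + ((z - c) ^ m + (-z - c) ^ m) +
      ((z - d) ^ m + (-z - d) ^ m) + ((z - e) ^ m + (-z - e) ^ m) + ((z - f) ^ m + (-z - f) ^ m)) +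
      ((a + b) ^ m + (a + c) ^ m + (a + d) ^ m + (a + e) ^ m + (a + f) ^ m +
      (b + c) ^ m + (b + d) ^ m + (b + e) ^ m + (b + f) ^ m + (c + d) ^ m + (c + e) ^ m +
      (c + f) ^ m + (d + e) ^ m + (d + f) ^ m + (e + f) ^ m) := by
  have h1 : (Finset.univ.filter (fun i : Fin 8 => i.val < 6)) = {0,1,2,3,4,5} := by decide
  have h2 : (Finset.univ.filter (fun p : Fin 8 × Fin 8 => p.1.val < p.2.val ∧ p.2.val < 6)) =
    {(0,1),(0,2),(0,3),(0,4),(0,5),(1,2),(1,3),(1,4),(1,5),(2,3),(2,4),(2,5),(3,4),(3,5),(4,5)} := by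
    decide
  have hf' : f = -(a + b + c + d + e) := by linarith
  have hw : (fun i => eval v (subE6 i)) = ![a, b, c, d, e, f, z, -z] := by
    funext i
    fin_cases i <;> simp [subE6, ha, hb, hc, hd, he, hz, hf']
  have hS : eval ![a, b, c, d, e, f, z, -z] S6 = 0 := by
    simp [S6]
    linarith
  rw [eval_aeval', hw, U, h1, h2]
  have hzz : (2 : ℚ)⁻¹ * (z + z) = z := by ring
  simp [hS, hzz, Finset.sum_insert, Finset.sum_singleton]
  ring

/-- Rational power sums of six numbers. -/
def ps (a b c d e f : ℚ) (k : ℕ) : ℚ := a ^ k + b ^ k + c ^ k + d ^ k + e ^ k + f ^ k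

theorem eval_pw (v : Fin 6 → ℚ) (k : ℕ) (a b c d e f : ℚ) (ha : v 0 = a) (hb : v 1 = b)
    (hc : v 2 = c) (hd : v 3 = d) (he : v 4 = e) (hf : a + b + c + d + e + f = 0) :
    eval v (pw k) = ps a b c d e f k := by
  have hf' : f = -(a + b + c + d + e) := by linarith
  simp [pw, xs, ps, Fin.sum_univ_succ, ha, hb, hc, hd, he, hf']
  ring

theorem u2_eq : u 2 = X 5 ^ 2 + C (1/2) * pw 2 := by
  apply MvPolynomial.funext
  intro v
  have h0 : v 0 + v 1 + v 2 + v 3 + v 4 + -(v 0 + v 1 + v 2 + v 3 + v 4) = 0 := by ring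
  simp only [u, if_true, map_add, map_mul, map_pow, eval_C, eval_X]
  rw [eval_U v 2 _ _ _ _ _ _ _ rfl rfl rfl rfl rfl rfl h0, eval_pw v 2 _ _ _ _ _ _ rfl rfl rfl rfl rfl h0]
  simp only [ps]
  ring

/-- Explicit form of `G`. -/
def Gx : Matrix (Fin 6) (Fin 6) ℚ :=
  !![1, 1/2, 1/2, 1/2, 1/2, 0; 1/2, 1, 1/2, 1/2, 1/2, 0; 1/2, 1/2, 1, 1/2, 1/2, 0;
     1/2, 1/2, 1/2, 1, 1/2, 0; 1/2, 1/2, 1/2, 1/2, 1, 0; 0, 0, 0, 0, 0, 1]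

/-- Explicit form of the inverse of `G`. -/
def Hx : Matrix (Fin 6) (Fin 6) ℚ :=
  !![5/3, -1/3, -1/3, -1/3, -1/3, 0; -1/3, 5/3, -1/3, -1/3, -1/3, 0;
     -1/3, -1/3, 5/3, -1/3, -1/3, 0; -1/3, -1/3, -1/3, 5/3, -1/3, 0;
     -1/3, -1/3, -1/3, -1/3, 5/3, 0; 0, 0, 0, 0, 0, 1]

theorem coeff_sq (i k : Fin 6) (m : Fin 6 →₀ ℕ) :
    coeff m (X i * X k : MvPolynomial (Fin 6) ℚ) =
      if Finsupp.single i 1 + Finsupp.single k 1 = m then 1 else 0 := by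
  rw [X, X, monomial_mul, coeff_monomial]
  simp

theorem u2_form : u 2 = ∑ i, ∑ j, C (Gx i j) * (X i * X j) := by
  rw [u2_eq]
  apply MvPolynomial.funext
  intro v
  simp [pw, xs, Gx, Fin.sum_univ_succ]
  ring

theorem GE6_eq : GE6 = Gx := by
  have hs : ∀ i j k l : Fin 6, (Finsupp.single i 1 + Finsupp.single j 1 : Fin 6 →₀ ℕ) =
      Finsupp.single k 1 + Finsupp.single l 1 ↔ (i = k ∧ j = l) ∨ (i = l ∧ j = k) := by
    intro i j k l
    rw [Finsupp.ext_iff]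
    simp only [Finsupp.add_apply, Finsupp.single_apply]
    revert i j k l
    decide
  have hd : ∀ i : Fin 6, (Finsupp.single i 2 : Fin 6 →₀ ℕ) =
      Finsupp.single i 1 + Finsupp.single i 1 := by
    intro i; rw [← Finsupp.single_add]
  have hsym : ∀ i j, Gx i j = Gx j i := by
    intro i j; fin_cases i <;> fin_cases j <;> rfl
  ext i j
  have key : ∀ k l, coeff (Finsupp.single k 1 + Finsupp.single l 1) (u 2) =
      if k = l then Gx k l else 2 * Gx k l := by
    intro k l
    rw [u2_form]
    simp only [coeff_sum, coeff_C_mul, coeff_sq, hs]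
    by_cases h : k = l
    · subst h
      rw [if_pos rfl, Finset.sum_eq_single k, Finset.sum_eq_single k]
      · simp
      · intro b _ hb
        simp [hb]
      · simp
      · intro b _ hb
        refine Finset.sum_eq_zero fun j _ => ?_
        simp [hb]
      · simp
    · have h2 : ∀ x y : Fin 6, (Gx x y * if (x = k ∧ y = l) ∨ (x = l ∧ y = k) then (1 : ℚ) else 0) =
          (if x = k then (if y = l then Gx k l else 0) else 0) +
          (if x = l then (if y = k then Gx l k else 0) else 0) := by
        intro x y
        by_cases hx : x = k
        · subst hx
          by_cases hy : y = l
          · subst hy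
            simp [h]
          · simp [h, hy]
        · by_cases hx' : x = l
          · subst hx'
            by_cases hy : y = k
            · subst hy
              simp [hx]
            · simp [hx, hy]
          · simp [hx, hx']
      simp only [h2, Finset.sum_add_distrib, Finset.sum_ite_irrel, Finset.sum_ite_eq',
        Finset.sum_const_zero, Finset.mem_univ, if_true, if_neg h]
      rw [hsym l k]
      ring
  unfold GE6
  rw [hd, key, key]
  by_cases h : i = j
  · simp [h]
  · simp [h]

theorem GE6_inv : GE6⁻¹ = Hx := by
  rw [GE6_eq]
  apply Matrix.inv_eq_right_inv
  ext i j
  fin_cases i <;> fin_cases j <;> simp [Gx, Hx, Matrix.mul_apply, Fin.sum_univ_succ] <;> norm_num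

theorem pair_symm (p q : MvPolynomial (Fin 6) ℚ) : pairE6 p q = pairE6 q p := by
  have hsym : ∀ i j, Hx i j = Hx j i := by
    intro i j; fin_cases i <;> fin_cases j <;> rfl
  unfold pairE6
  rw [GE6_inv, Finset.sum_comm]
  refine Finset.sum_congr rfl fun i _ => Finset.sum_congr rfl fun j _ => ?_
  rw [hsym]
  ring

theorem pderiv_chain (f : Fin 6 → MvPolynomial (Fin 6) ℚ) (A : MvPolynomial (Fin 6) ℚ) (i : Fin 6) :
    pderiv i (aeval f A) = ∑ k, aeval f (pderiv k A) * pderiv i (f k) := by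
  induction A using MvPolynomial.induction_on with
  | C a => simp
  | add p q hp hq => simp only [map_add, hp, hq, add_mul, Finset.sum_add_distrib]
  | mul_X p n hp =>
    simp only [map_mul, Derivation.leibniz, hp, smul_eq_mul, map_add, aeval_X, pderiv_X,
      Finset.mul_sum, add_mul, Finset.sum_add_distrib]
    congr 1
    · rw [Finset.sum_eq_single n]
      · simp
      · intro b _ hb
        simp [hb]
      · simp
    · refine Finset.sum_congr rfl fun j _ => ?_
      ring

theorem pair_chain (f : Fin 6 → MvPolynomial (Fin 6) ℚ) (N : Fin 6 → Fin 6 → MvPolynomial (Fin 6) ℚ)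
    (hN : ∀ k l, pairE6 (f k) (f l) = aeval f (N k l)) (A B : MvPolynomial (Fin 6) ℚ) :
    pairE6 (aeval f A) (aeval f B) =
      aeval f (∑ k, pderiv k A * ∑ l, pderiv l B * N k l) := by
  simp only [map_sum, map_mul, ← hN]
  unfold pairE6
  simp only [pderiv_chain, Finset.mul_sum, Finset.sum_mul]
  simp only [← Finset.sum_product', Finset.univ_product_univ]
  refine Finset.sum_bij' (fun x _ => (x.2.2.2, x.2.2.1, x.1, x.2.1))
    (fun y _ => (y.2.2.1, y.2.2.2, y.2.1, y.1)) ?_ ?_ ?_ ?_ ?_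
  · intros; exact Finset.mem_univ _
  · intros; exact Finset.mem_univ _
  · intros; rfl
  · intros; rfl
  · intros; ring

/-- The power sums in terms of `p₂, …, p₆`. -/
def PG : ℕ → MvPolynomial (Fin 6) ℚ
  | 0 => mo 6 0 0 0 0 0 0
  | 1 => 0
  | 2 => mo 1 0 1 0 0 0 0
  | 3 => mo 1 0 0 1 0 0 0
  | 4 => mo 1 0 0 0 1 0 0
  | 5 => mo 1 0 0 0 0 1 0
  | 6 => mo 1 0 0 0 0 0 1
  | 7 => mo (-7/24) 0 2 1 0 0 0 + mo (7/10) 0 1 0 0 1 0 + mo (7/12) 0 0 1 1 0 0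
  | 8 => mo (1/48) 0 4 0 0 0 0 + mo (-1/4) 0 2 0 1 0 0 + mo (-2/9) 0 1 2 0 0 0 +
    mo (2/3) 0 1 0 0 0 1 + mo (8/15) 0 0 1 0 1 0 + mo (1/4) 0 0 0 2 0 0
  | 9 => mo (-1/8) 0 3 1 0 0 0 + mo (9/40) 0 2 0 0 1 0 + mo (-1/18) 0 0 3 0 0 0 +
    mo (1/2) 0 0 1 0 0 1 + mo (9/20) 0 0 0 1 1 0
  | 10 => mo (1/96) 0 5 0 0 0 0 + mo (-5/48) 0 3 0 1 0 0 + mo (-5/24) 0 2 2 0 0 0 +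
    mo (5/24) 0 2 0 0 0 1 + mo (1/3) 0 1 1 0 1 0 + mo (5/36) 0 0 2 1 0 0 +
    mo (5/12) 0 0 0 1 0 1 + mo (1/5) 0 0 0 0 2 0
  | 11 => mo (-11/576) 0 4 1 0 0 0 + mo (11/240) 0 3 0 0 1 0 + mo (-11/48) 0 2 1 1 0 0 +
    mo (-11/108) 0 1 3 0 0 0 + mo (11/36) 0 1 1 0 0 1 + mo (11/40) 0 1 0 1 1 0 +
    mo (11/90) 0 0 2 0 1 0 + mo (11/48) 0 0 1 2 0 0 + mo (11/30) 0 0 0 0 1 1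
  | 12 => mo (1/384) 0 6 0 0 0 0 + mo (-1/64) 0 4 0 1 0 0 + mo (-5/72) 0 3 2 0 0 0 +
    mo (1/24) 0 3 0 0 0 1 + mo (-3/32) 0 2 0 2 0 0 + mo (-1/12) 0 1 2 1 0 0 +
    mo (1/4) 0 1 0 1 0 1 + mo (6/25) 0 1 0 0 2 0 + mo (-1/54) 0 0 4 0 0 0 +
    mo (1/9) 0 0 2 0 0 1 + mo (2/5) 0 0 1 1 1 0 + mo (1/16) 0 0 0 3 0 0 +
    mo (1/6) 0 0 0 0 0 2
  | _ => 0

theorem root_newton (a b c d e f x : ℚ) (h : a + b + c + d + e + f = 0) :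
    (x - a) * (x - b) * (x - c) * (x - d) * (x - e) * (x - f) =
    x ^ 6 - (1/2 * ps a b c d e f 2 * x ^ 4 + 1/3 * ps a b c d e f 3 * x ^ 3 +
      (1/4 * ps a b c d e f 4 - 1/8 * ps a b c d e f 2 ^ 2) * x ^ 2 +
      (1/5 * ps a b c d e f 5 - 1/6 * ps a b c d e f 2 * ps a b c d e f 3) * x +
      (1/6 * ps a b c d e f 6 - 1/8 * ps a b c d e f 2 * ps a b c d e f 4 -
        1/18 * ps a b c d e f 3 ^ 2 + 1/48 * ps a b c d e f 2 ^ 3)) := by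
  have hf' : f = -(a + b + c + d + e) := by linarith
  subst hf'
  simp only [ps]
  ring

theorem newton (a b c d e f : ℚ) (h : a + b + c + d + e + f = 0) (k : ℕ) :
    ps a b c d e f (k + 6) =
      1/2 * ps a b c d e f 2 * ps a b c d e f (k + 4) +
      1/3 * ps a b c d e f 3 * ps a b c d e f (k + 3) +
      (1/4 * ps a b c d e f 4 - 1/8 * ps a b c d e f 2 ^ 2) * ps a b c d e f (k + 2) +
      (1/5 * ps a b c d e f 5 - 1/6 * ps a b c d e f 2 * ps a b c d e f 3) *
        ps a b c d e f (k + 1) +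
      (1/6 * ps a b c d e f 6 - 1/8 * ps a b c d e f 2 * ps a b c d e f 4 -
        1/18 * ps a b c d e f 3 ^ 2 + 1/48 * ps a b c d e f 2 ^ 3) * ps a b c d e f k := by
  have ha := root_newton a b c d e f a h
  have hb := root_newton a b c d e f b h
  have hc := root_newton a b c d e f c h
  have hd := root_newton a b c d e f d h
  have he := root_newton a b c d e f e h
  have hf := root_newton a b c d e f f h
  simp only [sub_self, zero_mul, mul_zero] at ha hb hc hd he hf
  generalize hp2 : ps a b c d e f 2 = p2 at *
  generalize hp3 : ps a b c d e f 3 = p3 at *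
  generalize hp4 : ps a b c d e f 4 = p4 at *
  generalize hp5 : ps a b c d e f 5 = p5 at *
  generalize hp6 : ps a b c d e f 6 = p6 at *
  simp only [ps]
  linear_combination -a ^ k * ha - b ^ k * hb - c ^ k * hc - d ^ k * hd - e ^ k * he - f ^ k * hf

/-- Values of the first set of generators at a point. -/
theorem eval_gg (v : Fin 6 → ℚ) (a b c d e f z : ℚ) (ha : v 0 = a) (hb : v 1 = b)
    (hc : v 2 = c) (hd : v 3 = d) (he : v 4 = e) (hz : v 5 = z) (hf : a + b + c + d + e + f = 0) :
    (fun i => eval v (gg i)) = ![z ^ 2, ps a b c d e f 2, ps a b c d e f 3, ps a b c d e f 4,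
      ps a b c d e f 5, ps a b c d e f 6] := by
  have H := fun k => eval_pw v k a b c d e f ha hb hc hd he hf
  funext i
  fin_cases i <;> simp [gg, H, hz]

theorem ps_eq (a b c d e f w : ℚ) (h : a + b + c + d + e + f = 0) (k : ℕ) (hk : k ≤ 12) :
    ps a b c d e f k = eval ![w, ps a b c d e f 2, ps a b c d e f 3, ps a b c d e f 4,
      ps a b c d e f 5, ps a b c d e f 6] (PG k) := by
  have h0 : ps a b c d e f 0 = 6 := by simp only [ps]; norm_num
  have h1 : ps a b c d e f 1 = 0 := by simp only [ps]; linarith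
  have h7 := newton a b c d e f h 1
  have h8 := newton a b c d e f h 2
  have h9 := newton a b c d e f h 3
  have h10 := newton a b c d e f h 4
  have h11 := newton a b c d e f h 5
  have h12 := newton a b c d e f h 6
  norm_num only at h7 h8 h9 h10 h11 h12
  rw [h1] at h7
  rw [h7] at h9 h10 h11 h12
  rw [h8] at h10 h11 h12
  rw [h9] at h11 h12
  rw [h10] at h12
  interval_cases k
  · simp [PG, eval_mo, h0]
  · simp [PG, h1]
  · simp [PG, eval_mo]
  · simp [PG, eval_mo]
  · simp [PG, eval_mo]
  · simp [PG, eval_mo]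
  · simp [PG, eval_mo]
  · simp only [PG, map_add, eval_mo, Matrix.cons_val]; rw [h7]; ring
  · simp only [PG, map_add, eval_mo, Matrix.cons_val]; rw [h8]; ring
  · simp only [PG, map_add, eval_mo, Matrix.cons_val]; rw [h9]; ring
  · simp only [PG, map_add, eval_mo, Matrix.cons_val]; rw [h10]; ring
  · simp only [PG, map_add, eval_mo, Matrix.cons_val]; rw [h11]; ring
  · simp only [PG, map_add, eval_mo, Matrix.cons_val]; rw [h12]; ring

theorem pw_eq (k : ℕ) (hk : k ≤ 12) : pw k = aeval gg (PG k) := by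
  apply MvPolynomial.funext
  intro v
  have h0 : v 0 + v 1 + v 2 + v 3 + v 4 + -(v 0 + v 1 + v 2 + v 3 + v 4) = 0 := by ring
  rw [eval_aeval', eval_gg v _ _ _ _ _ _ _ rfl rfl rfl rfl rfl rfl h0,
    eval_pw v k _ _ _ _ _ _ rfl rfl rfl rfl rfl h0]
  exact ps_eq _ _ _ _ _ _ _ h0 k hk

theorem pderiv_pw (k : ℕ) (i : Fin 6) : pderiv i (pw (k + 1)) =
    C ((k : ℚ) + 1) * (![xs 0 ^ k - xs 5 ^ k, xs 1 ^ k - xs 5 ^ k, xs 2 ^ k - xs 5 ^ k,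
      xs 3 ^ k - xs 5 ^ k, xs 4 ^ k - xs 5 ^ k, 0] i) := by
  simp only [pw, Fin.sum_univ_six, map_add, Derivation.leibniz_pow, Nat.add_sub_cancel]
  fin_cases i <;> simp [xs, pderiv_X] <;> ring

theorem pair_pw (a b : ℕ) : pairE6 (pw (a + 1)) (pw (b + 1)) =
    C (2 * ((a : ℚ) + 1) * ((b : ℚ) + 1)) * (pw (a + b) - C (1/6) * pw a * pw b) := by
  apply MvPolynomial.funext
  intro v
  simp only [pairE6, GE6_inv, pderiv_pw]
  simp only [pw]
  generalize xs = y
  simp only [Fin.sum_univ_six, map_add, map_mul, map_sub, map_pow, map_one, eval_C, pow_add]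
  simp [Hx]
  ring

theorem pderiv_w (i : Fin 6) : pderiv i (X 5 ^ 2 : MvPolynomial (Fin 6) ℚ) =
    ![0, 0, 0, 0, 0, 2 * X 5] i := by
  fin_cases i <;> simp [pderiv_X, Derivation.leibniz_pow]

theorem pair_w_w : pairE6 (X 5 ^ 2) (X 5 ^ 2) = C 4 * X 5 ^ 2 := by
  apply MvPolynomial.funext
  intro v
  simp only [pairE6, GE6_inv, pderiv_w]
  simp [Hx, Fin.sum_univ_six]
  ring

theorem pair_w_pw (b : ℕ) : pairE6 (X 5 ^ 2) (pw (b + 1)) = 0 := by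
  simp only [pairE6, GE6_inv, pderiv_w, pderiv_pw]
  simp [Hx, Fin.sum_univ_six]

/-- Gram matrix of the power sums. -/
def NP (a b : ℕ) : MvPolynomial (Fin 6) ℚ :=
  C (2 * ((a : ℚ) + 1) * ((b : ℚ) + 1)) * (PG (a + b) - C (1/6) * PG a * PG b)

/-- Gram matrix of the first set of generators. -/
def NG : Fin 6 → Fin 6 → MvPolynomial (Fin 6) ℚ :=
  ![![C 4 * X 0, 0, 0, 0, 0, 0],
    ![0, NP 1 1, NP 1 2, NP 1 3, NP 1 4, NP 1 5],
    ![0, NP 2 1, NP 2 2, NP 2 3, NP 2 4, NP 2 5],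
    ![0, NP 3 1, NP 3 2, NP 3 3, NP 3 4, NP 3 5],
    ![0, NP 4 1, NP 4 2, NP 4 3, NP 4 4, NP 4 5],
    ![0, NP 5 1, NP 5 2, NP 5 3, NP 5 4, NP 5 5]]

theorem pair_NP (a b : ℕ) (ha : a ≤ 5) (hb : b ≤ 5) :
    pairE6 (pw (a + 1)) (pw (b + 1)) = aeval gg (NP a b) := by
  rw [pair_pw, pw_eq (a + b) (by omega), pw_eq a (by omega), pw_eq b (by omega)]
  simp only [NP, map_mul, map_sub, algHom_C, algebraMap_eq]

theorem pair_gg (k l : Fin 6) : pairE6 (gg k) (gg l) = aeval gg (NG k l) := by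
  have key : ∀ i : Fin 6, gg i = if i = 0 then X 5 ^ 2 else pw (i.val + 1) := by
    intro i; fin_cases i <;> rfl
  have kN : ∀ i j : Fin 6, NG i j = if i = 0 then (if j = 0 then C 4 * X 0 else 0) else
      (if j = 0 then 0 else NP i.val j.val) := by
    intro i j; fin_cases i <;> fin_cases j <;> rfl
  rw [kN, key k, key l]
  by_cases hk : k = 0
  · by_cases hl : l = 0
    · simp only [hk, hl, if_true, pair_w_w, map_mul, algHom_C, algebraMap_eq, aeval_X]
      rfl
    · simp only [hk, hl, if_true, if_false, pair_w_pw, map_zero]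
  · by_cases hl : l = 0
    · simp only [hk, hl, if_true, if_false, map_zero]
      rw [pair_symm, pair_w_pw]
    · simp only [hk, hl, if_false]
      exact pair_NP _ _ (by omega) (by omega)
/-- The second set of generators in terms of `w, p₂, …, p₆`. -/
def FG0 : MvPolynomial (Fin 6) ℚ :=
  mo 1 1 0 0 0 0 0 + mo (1/2) 0 1 0 0 0 0

/-- The second set of generators in terms of `w, p₂, …, p₆`. -/
def FG1 : MvPolynomial (Fin 6) ℚ :=
  mo 1 1 0 0 0 0 0

/-- The second set of generators in terms of `w, p₂, …, p₆`. -/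
def FG2 : MvPolynomial (Fin 6) ℚ :=
  mo 1 0 0 1 0 0 0

/-- The second set of generators in terms of `w, p₂, …, p₆`. -/
def FG3 : MvPolynomial (Fin 6) ℚ :=
  mo 1 0 0 0 1 0 0

/-- The second set of generators in terms of `w, p₂, …, p₆`. -/
def FG4 : MvPolynomial (Fin 6) ℚ :=
  mo (-20) 1 0 1 0 0 0 + mo 10 0 1 1 0 0 0 + mo (-12) 0 0 0 0 1 0

/-- The second set of generators in terms of `w, p₂, …, p₆`. -/
def FG5 : MvPolynomial (Fin 6) ℚ :=
  mo (-3) 3 0 0 0 0 0 + mo (15/2) 2 1 0 0 0 0 + mo (-45/4) 1 2 0 0 0 0 + mo 30 1 0 0 1 0 0 +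
  mo (-15/8) 0 3 0 0 0 0 + mo 15 0 1 0 1 0 0 + mo 10 0 0 2 0 0 0 + mo (-24) 0 0 0 0 0 1

/-- The second set of generators in terms of `w, p₂, …, p₆`. -/
def FG : Fin 6 → MvPolynomial (Fin 6) ℚ := ![FG0, FG1, FG2, FG3, FG4, FG5]

/-- The flat polynomials in terms of the second set of generators. -/
def TF0 : MvPolynomial (Fin 6) ℚ :=
  mo 1 1 0 0 0 0 0

/-- The flat polynomials in terms of the second set of generators. -/
def TF1 : MvPolynomial (Fin 6) ℚ :=
  mo 1 0 0 0 0 1 0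

/-- The flat polynomials in terms of the second set of generators. -/
def TF2 : MvPolynomial (Fin 6) ℚ :=
  mo 1 0 0 0 0 0 1

/-- The flat polynomials in terms of the second set of generators. -/
def TF3 : MvPolynomial (Fin 6) ℚ :=
  mo (55/64) 4 0 0 0 0 0 + mo (45/4) 3 1 0 0 0 0 + mo (-375/4) 2 2 0 0 0 0 +
  mo (-15/8) 2 0 0 1 0 0 + mo 165 1 3 0 0 0 0 + mo (-15/2) 1 1 0 1 0 0 +
  mo (-5/8) 1 0 2 0 0 0 + mo (5/32) 1 0 0 0 0 1 + mo (-345/4) 0 4 0 0 0 0 +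
  mo (195/4) 0 2 0 1 0 0 + mo (15/2) 0 1 2 0 0 0 + mo (-5/4) 0 1 0 0 0 1 +
  mo (1/8) 0 0 1 0 1 0 + mo (15/16) 0 0 0 2 0 0

/-- The flat polynomials in terms of the second set of generators. -/
def TF4 : MvPolynomial (Fin 6) ℚ :=
  mo (-9/4) 3 0 1 0 0 0 + mo 36 2 1 1 0 0 0 + mo (3/10) 2 0 0 0 1 0 +
  mo (-105) 1 2 1 0 0 0 + mo (-9/5) 1 1 0 0 1 0 + mo (3/2) 1 0 1 1 0 0 +
  mo 108 0 3 1 0 0 0 + mo (33/10) 0 2 0 0 1 0 + mo (-18) 0 1 1 1 0 0 +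
  mo (-1/2) 0 0 3 0 0 0 + mo (1/4) 0 0 1 0 0 1 + mo (-3/20) 0 0 0 1 1 0

/-- The flat polynomials in terms of the second set of generators. -/
def TF5 : MvPolynomial (Fin 6) ℚ :=
  mo (405/64) 6 0 0 0 0 0 + mo (-405/4) 5 1 0 0 0 0 + mo (3105/4) 4 2 0 0 0 0 +
  mo (-135/8) 4 0 0 1 0 0 + mo (-1215) 3 3 0 0 0 0 + mo (405/2) 3 1 0 1 0 0 +
  mo (-45/4) 3 0 2 0 0 0 + mo (5/16) 3 0 0 0 0 1 + mo (-5175/4) 2 4 0 0 0 0 +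
  mo (-5715/4) 2 2 0 1 0 0 + mo (45/2) 2 1 2 0 0 0 + mo (45/4) 2 1 0 0 0 1 +
  mo (9/8) 2 0 1 0 1 0 + mo (225/16) 2 0 0 2 0 0 + mo 3960 1 5 0 0 0 0 +
  mo 1800 1 3 0 1 0 0 + mo 195 1 2 2 0 0 0 + mo 9 1 1 1 0 1 0 + mo (-90) 1 1 0 2 0 0 +
  mo (15/2) 1 0 2 1 0 0 + mo (3/40) 1 0 0 0 2 0 + mo (-2190) 0 6 0 0 0 0 +
  mo (-45) 0 4 0 1 0 0 + mo (-720) 0 3 2 0 0 0 + mo (-30) 0 3 0 0 0 1 +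
  mo (-111/2) 0 2 1 0 1 0 + mo (1035/2) 0 2 0 2 0 0 + mo (-15) 0 1 0 1 0 1 +
  mo (-9/10) 0 1 0 0 2 0 + mo (-15/8) 0 0 4 0 0 0 + mo (5/8) 0 0 2 0 0 1 +
  mo (-3/4) 0 0 1 1 1 0 + mo (-15/4) 0 0 0 3 0 0 + mo (5/64) 0 0 0 0 0 2

/-- The flat polynomials in terms of the second set of generators. -/
def TF : Fin 6 → MvPolynomial (Fin 6) ℚ := ![TF0, TF1, TF2, TF3, TF4, TF5]

/-- Entry of the Gram matrix of the second set of generators. -/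
def MF00 : MvPolynomial (Fin 6) ℚ :=
  mo 4 1 0 0 0 0 0

/-- Entry of the Gram matrix of the second set of generators. -/
def MF01 : MvPolynomial (Fin 6) ℚ :=
  mo 4 0 1 0 0 0 0

/-- Entry of the Gram matrix of the second set of generators. -/
def MF02 : MvPolynomial (Fin 6) ℚ :=
  mo 6 0 0 1 0 0 0

/-- Entry of the Gram matrix of the second set of generators. -/
def MF03 : MvPolynomial (Fin 6) ℚ :=
  mo 8 0 0 0 1 0 0

/-- Entry of the Gram matrix of the second set of generators. -/
def MF04 : MvPolynomial (Fin 6) ℚ :=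
  mo 10 0 0 0 0 1 0

/-- Entry of the Gram matrix of the second set of generators. -/
def MF05 : MvPolynomial (Fin 6) ℚ :=
  mo 12 0 0 0 0 0 1

/-- Entry of the Gram matrix of the second set of generators. -/
def MF11 : MvPolynomial (Fin 6) ℚ :=
  mo 4 0 1 0 0 0 0

/-- Entry of the Gram matrix of the second set of generators. -/
def MF12 : MvPolynomial (Fin 6) ℚ :=
  0

/-- Entry of the Gram matrix of the second set of generators. -/
def MF13 : MvPolynomial (Fin 6) ℚ :=
  0

/-- Entry of the Gram matrix of the second set of generators. -/
def MF14 : MvPolynomial (Fin 6) ℚ :=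
  mo (-80) 0 1 1 0 0 0

/-- Entry of the Gram matrix of the second set of generators. -/
def MF15 : MvPolynomial (Fin 6) ℚ :=
  mo (-180) 2 1 0 0 0 0 + mo 480 1 2 0 0 0 0 + mo (-336) 0 3 0 0 0 0 + mo 120 0 1 0 1 0 0

/-- Entry of the Gram matrix of the second set of generators. -/
def MF22 : MvPolynomial (Fin 6) ℚ :=
  mo (-12) 2 0 0 0 0 0 + mo 24 1 1 0 0 0 0 + mo (-12) 0 2 0 0 0 0 + mo 18 0 0 0 1 0 0

/-- Entry of the Gram matrix of the second set of generators. -/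
def MF23 : MvPolynomial (Fin 6) ℚ :=
  mo 32 1 0 1 0 0 0 + mo (-72) 0 1 1 0 0 0 + mo (-2) 0 0 0 0 1 0

/-- Entry of the Gram matrix of the second set of generators. -/
def MF24 : MvPolynomial (Fin 6) ℚ :=
  mo (-15) 3 0 0 0 0 0 + mo 960 2 1 0 0 0 0 + mo (-2100) 1 2 0 0 0 0 + mo 30 1 0 0 1 0 0 +
  mo 1200 0 3 0 0 0 0 + mo (-840) 0 1 0 1 0 0 + mo (-30) 0 0 2 0 0 0 + mo 15 0 0 0 0 0 1

/-- Entry of the Gram matrix of the second set of generators. -/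
def MF25 : MvPolynomial (Fin 6) ℚ :=
  mo (-78) 2 0 1 0 0 0 + mo 912 1 1 1 0 0 0 + mo (84/5) 1 0 0 0 1 0 +
  mo (-1944) 0 2 1 0 0 0 + mo (-384/5) 0 1 0 0 1 0 + mo 36 0 0 1 1 0 0

/-- Entry of the Gram matrix of the second set of generators. -/
def MF33 : MvPolynomial (Fin 6) ℚ :=
  mo (-20) 3 0 0 0 0 0 + mo 80 1 2 0 0 0 0 + mo 40 1 0 0 1 0 0 + mo (-64) 0 3 0 0 0 0 +
  mo 8 0 0 2 0 0 0 + mo (-4/3) 0 0 0 0 0 1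

/-- Entry of the Gram matrix of the second set of generators. -/
def MF34 : MvPolynomial (Fin 6) ℚ :=
  mo 80 2 0 1 0 0 0 + mo (-480) 1 1 1 0 0 0 + mo 16 1 0 0 0 1 0 + mo 1200 0 2 1 0 0 0 +
  mo 24 0 1 0 0 1 0 + mo (-40) 0 0 1 1 0 0

/-- Entry of the Gram matrix of the second set of generators. -/
def MF35 : MvPolynomial (Fin 6) ℚ :=
  mo (-24) 4 0 0 0 0 0 + mo 576 3 1 0 0 0 0 + mo (-3744) 2 2 0 0 0 0 + mo 72 2 0 0 1 0 0 +
  mo 6528 1 3 0 0 0 0 + mo (-384) 1 1 0 1 0 0 + mo 48 1 0 2 0 0 0 + mo 24 1 0 0 0 0 1 +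
  mo (-3456) 0 4 0 0 0 0 + mo 1632 0 2 0 1 0 0 + mo 96 0 1 2 0 0 0 + mo (-64) 0 1 0 0 0 1 +
  mo (-24/5) 0 0 1 0 1 0 + mo (-48) 0 0 0 2 0 0

/-- Entry of the Gram matrix of the second set of generators. -/
def MF44 : MvPolynomial (Fin 6) ℚ :=
  mo 600 4 0 0 0 0 0 + mo 7200 3 1 0 0 0 0 + mo (-60000) 2 2 0 0 0 0 +
  mo (-1200) 2 0 0 1 0 0 + mo 105600 1 3 0 0 0 0 + mo (-4800) 1 1 0 1 0 0 +
  mo (-400) 1 0 2 0 0 0 + mo 200 1 0 0 0 0 1 + mo (-55200) 0 4 0 0 0 0 +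
  mo 31200 0 2 0 1 0 0 + mo 4800 0 1 2 0 0 0 + mo (-800) 0 1 0 0 0 1 + mo 80 0 0 1 0 1 0 +
  mo 600 0 0 0 2 0 0

/-- Entry of the Gram matrix of the second set of generators. -/
def MF45 : MvPolynomial (Fin 6) ℚ :=
  mo (-1620) 3 0 1 0 0 0 + mo 25920 2 1 1 0 0 0 + mo 270 2 0 0 0 1 0 +
  mo (-75600) 1 2 1 0 0 0 + mo (-1296) 1 1 0 0 1 0 + mo 1080 1 0 1 1 0 0 +
  mo 77760 0 3 1 0 0 0 + mo 2376 0 2 0 0 1 0 + mo (-12960) 0 1 1 1 0 0 +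
  mo (-360) 0 0 3 0 0 0 + mo 180 0 0 1 0 0 1 + mo (-108) 0 0 0 1 1 0

/-- Entry of the Gram matrix of the second set of generators. -/
def MF55 : MvPolynomial (Fin 6) ℚ :=
  mo 684 5 0 0 0 0 0 + mo 8640 4 1 0 0 0 0 + mo (-72000) 3 2 0 0 0 0 +
  mo (-1440) 3 0 0 1 0 0 + mo 126720 2 3 0 0 0 0 + mo (-5760) 2 1 0 1 0 0 +
  mo (-480) 2 0 2 0 0 0 + mo 120 2 0 0 0 0 1 + mo (-66240) 1 4 0 0 0 0 +
  mo 37440 1 2 0 1 0 0 + mo 5760 1 1 2 0 0 0 + mo (-960) 1 1 0 0 0 1 + mo 96 1 0 1 0 1 0 +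
  mo 720 1 0 0 2 0 0 + mo (48/5) 0 0 0 0 2 0

/-- Gram matrix of the second set of generators. -/
def MF : Fin 6 → Fin 6 → MvPolynomial (Fin 6) ℚ :=
  ![![MF00, MF01, MF02, MF03, MF04, MF05],
    ![MF01, MF11, MF12, MF13, MF14, MF15],
    ![MF02, MF12, MF22, MF23, MF24, MF25],
    ![MF03, MF13, MF23, MF33, MF34, MF35],
    ![MF04, MF14, MF24, MF34, MF44, MF45],
    ![MF05, MF15, MF25, MF35, MF45, MF55]]

/-- Row of the polynomials `Q_{αβ}` (only the entries with `α ≤ β` are used). -/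
def QF0 : Fin 6 → MvPolynomial (Fin 5) ℚ :=
  ![mq 4 1 0 0 0 0,
    mq 10 0 1 0 0 0,
    mq 12 0 0 1 0 0,
    mq 16 0 0 0 1 0,
    mq 18 0 0 0 0 1,
    0]

/-- Row of the polynomials `Q_{αβ}` (only the entries with `α ≤ β` are used). -/
def QF1 : Fin 6 → MvPolynomial (Fin 5) ℚ :=
  ![0,
    mq 50 4 0 0 0 0 + mq 100 1 0 1 0 0 + mq 640 0 0 0 1 0,
    mq 54 2 1 0 0 0 + mq 720 0 0 0 0 1,
    mq (55/16) 3 1 0 0 0 + mq (275/2) 1 0 0 0 1 + mq (55/16) 0 1 1 0 0,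
    mq (15/4) 3 0 1 0 0 + mq 72 2 0 0 1 0 + mq (9/5) 1 2 0 0 0 + mq (15/8) 0 0 2 0 0,
    mq 375 3 0 0 0 1 + mq (225/16) 2 1 1 0 0 + mq 180 1 1 0 1 0 + mq (3/4) 0 3 0 0 0 +
    mq (375/2) 0 0 1 0 1]

/-- Row of the polynomials `Q_{αβ}` (only the entries with `α ≤ β` are used). -/
def QF2 : Fin 6 → MvPolynomial (Fin 5) ℚ :=
  ![0,
    0,
    mq 24 5 0 0 0 0 + mq 768 1 0 0 1 0 + mq (48/5) 0 2 0 0 0,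
    mq (15/2) 3 0 1 0 0 + mq (9/5) 1 2 0 0 0,
    mq (39/20) 4 1 0 0 0 + mq 78 2 0 0 0 1 + mq (39/10) 1 1 1 0 0 + mq (624/25) 0 1 0 1 0,
    mq 192 4 0 0 1 0 + mq (24/5) 3 2 0 0 0 + mq 15 2 0 2 0 0 + mq 192 1 1 0 0 1 +
    mq (12/5) 0 2 1 0 0 + mq (3072/5) 0 0 0 2 0]

/-- Row of the polynomials `Q_{αβ}` (only the entries with `α ≤ β` are used). -/
def QF3 : Fin 6 → MvPolynomial (Fin 5) ℚ :=
  ![0,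
    0,
    0,
    mq (25/128) 7 0 0 0 0 + mq (35/4) 3 0 0 1 0 + mq (21/64) 2 2 0 0 0 +
    mq (175/256) 1 0 2 0 0 + mq (35/8) 0 1 0 0 1,
    mq (45/128) 5 1 0 0 0 + mq (75/16) 3 0 0 0 1 + mq (45/64) 2 1 1 0 0 + mq (9/2) 1 1 0 1 0 +
    mq (3/80) 0 3 0 0 0 + mq (75/16) 0 0 1 0 1,
    mq (225/128) 6 0 1 0 0 + mq (135/128) 4 2 0 0 0 + mq (135/8) 2 1 0 0 1 +
    mq (135/4) 2 0 1 1 0 + mq (27/32) 1 2 1 0 0 + mq (27/10) 0 2 0 1 0 +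
    mq (75/256) 0 0 3 0 0 + mq (225/2) 0 0 0 0 2]

/-- Row of the polynomials `Q_{αβ}` (only the entries with `α ≤ β` are used). -/
def QF4 : Fin 6 → MvPolynomial (Fin 5) ℚ :=
  ![0,
    0,
    0,
    0,
    mq (3/32) 8 0 0 0 0 + mq (3/8) 5 0 1 0 0 + mq (12/5) 4 0 0 1 0 + mq (9/25) 3 2 0 0 0 +
    mq (3/8) 2 0 2 0 0 + mq (24/5) 1 1 0 0 1 + mq (24/5) 1 0 1 1 0 + mq (3/25) 0 2 1 0 0 +
    mq (384/25) 0 0 0 2 0,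
    mq (57/64) 7 1 0 0 0 + mq (285/128) 4 1 1 0 0 + mq (57/5) 3 1 0 1 0 +
    mq (171/400) 2 3 0 0 0 + mq (285/16) 2 0 1 0 1 + mq (57/64) 1 1 2 0 0 + mq 228 1 0 0 1 1 +
    mq (57/20) 0 2 0 0 1 + mq (57/10) 0 1 1 1 0]

/-- Row of the polynomials `Q_{αβ}` (only the entries with `α ≤ β` are used). -/
def QF5 : Fin 6 → MvPolynomial (Fin 5) ℚ :=
  ![0,
    0,
    0,
    0,
    0,
    mq (75/64) 11 0 0 0 0 + mq (231/64) 6 2 0 0 0 + mq (825/128) 5 0 2 0 0 +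
    mq (165/32) 3 2 1 0 0 + mq 528 3 0 0 2 0 + mq (99/5) 2 2 0 1 0 + mq 825 2 0 0 0 2 +
    mq (99/400) 1 4 0 0 0 + mq (165/4) 1 1 1 0 1 + mq (165/4) 1 0 2 1 0 +
    mq (33/64) 0 2 2 0 0 + mq 264 0 1 0 1 1]

/-- The polynomials `Q_{αβ}`. -/
def QF : Fin 6 → Fin 6 → MvPolynomial (Fin 5) ℚ :=
  ![QF0, QF1, QF2, QF3, QF4, QF5]

/-- The second set of generators. -/
def ff (k : Fin 6) : MvPolynomial (Fin 6) ℚ := aeval gg (FG k)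

set_option linter.all false in
set_option maxRecDepth 1000000 in
set_option maxHeartbeats 0 in
theorem FG_pair (k l : Fin 6) (h : l ≤ k) :
    (∑ i, pderiv i (FG k) * ∑ j, pderiv j (FG l) * NG i j) = aeval FG (MF k l) := by
  apply MvPolynomial.funext
  intro v
  rw [eval_aeval']
  generalize h0 : v 0 = a
  generalize h1 : v 1 = b
  generalize h2 : v 2 = c
  generalize h3 : v 3 = d
  generalize h4 : v 4 = e
  generalize h5 : v 5 = f
  revert h
  fin_cases k <;> fin_cases l <;> intro h <;> first | exact absurd h (by decide) | skip
  all_goals as_aux_lemma =>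
    clear h
    simp only [Fin.sum_univ_six, Matrix.cons_val, Fin.mk_one, Fin.reduceFinMk, Fin.zero_eta,
      Fin.isValue, FG, FG0, FG1, FG2, FG3, FG4, FG5, NG, NP, PG, MF, MF00, MF01, MF02, MF03, MF04, MF05, MF11, MF12, MF13, MF14, MF15, MF22, MF23, MF24, MF25, MF33, MF34, MF35, MF44, MF45, MF55,
      map_add, map_mul, map_sub, map_zero, eval_mo, pd0, pd1, pd2, pd3, pd4, pd5, eval_C, eval_X,
      h0, h1, h2, h3, h4, h5, Nat.reduceAdd, Nat.reduceSub, Nat.cast_zero, Nat.cast_one,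
      Nat.cast_ofNat, mul_zero, zero_mul, add_zero, zero_add, mul_one, one_mul, pow_zero, pow_one]
    try ring

set_option linter.all false in
set_option maxRecDepth 1000000 in
set_option maxHeartbeats 0 in
theorem TF_pair (k l : Fin 6) (h : l ≤ k) :
    (∑ i, pderiv i (TF k) * ∑ j, pderiv j (TF l) * MF i j) =
      C (if k.val + l.val = 5 then 24 else 0) * TF 5 +
        aeval (fun i : Fin 5 => TF i.castSucc) (QF l k) := by
  apply MvPolynomial.funext
  intro v
  rw [map_add, eval_aeval']
  generalize h0 : v 0 = a
  generalize h1 : v 1 = b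
  generalize h2 : v 2 = c
  generalize h3 : v 3 = d
  generalize h4 : v 4 = e
  generalize h5 : v 5 = f
  revert h
  fin_cases k <;> fin_cases l <;> intro h <;> first | exact absurd h (by decide) | skip
  all_goals as_aux_lemma =>
    clear h
    simp only [Fin.sum_univ_six, Matrix.cons_val, Fin.mk_one, Fin.reduceFinMk, Fin.zero_eta,
      Fin.isValue, TF, TF0, TF1, TF2, TF3, TF4, TF5, QF, QF0, QF1, QF2, QF3, QF4, QF5,
      MF, MF00, MF01, MF02, MF03, MF04, MF05, MF11, MF12, MF13, MF14, MF15, MF22, MF23, MF24, MF25, MF33, MF34, MF35, MF44, MF45, MF55, Fin.castSucc_zero, Fin.castSucc_one, Fin.reduceCastSucc,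
      map_add, map_mul, map_sub, map_zero, eval_mo, eval_mq, pd0, pd1, pd2, pd3, pd4, pd5, eval_C,
      h0, h1, h2, h3, h4, h5, Nat.reduceAdd, Nat.reduceSub, Nat.cast_zero, Nat.cast_one,
      Nat.cast_ofNat, Nat.reduceEqDiff, if_true, if_false,
      mul_zero, zero_mul, add_zero, zero_add, mul_one, one_mul, pow_zero, pow_one]
    try ring

theorem MF_symm (k l : Fin 6) : MF k l = MF l k := by
  fin_cases k <;> fin_cases l <;>
    simp only [MF, Matrix.cons_val, Fin.mk_one, Fin.reduceFinMk, Fin.zero_eta, Fin.isValue]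

theorem ff_aeval (A : MvPolynomial (Fin 6) ℚ) : aeval ff A = aeval gg (aeval FG A) := by
  apply MvPolynomial.funext
  intro v
  simp only [eval_aeval', ff]

theorem pair_ff (k l : Fin 6) : pairE6 (ff k) (ff l) = aeval ff (MF k l) := by
  have key : ∀ k l, l ≤ k → pairE6 (ff k) (ff l) = aeval ff (MF k l) := by
    intro k l h
    rw [ff_aeval, ← FG_pair k l h]
    exact pair_chain gg NG pair_gg (FG k) (FG l)
  rcases le_total l k with h | h
  · exact key k l h
  · rw [pair_symm, MF_symm]
    exact key l k h

set_option maxHeartbeats 4000000 in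
/-- Expression of `U_m` through power sums: linear part. -/
theorem eval_u (v : Fin 6 → ℚ) (a b c d e f z : ℚ) (ha : v 0 = a) (hb : v 1 = b)
    (hc : v 2 = c) (hd : v 3 = d) (he : v 4 = e) (hz : v 5 = z) (hf : a + b + c + d + e + f = 0)
    (p : ℕ → ℚ) (hp : ps a b c d e f = p) :
    eval v (u 5) = -12 * p 5 - 20 * p 3 * z ^ 2 + 10 * p 2 * p 3 ∧
    eval v (u 6) = 2 * 6 * z ^ 6 + 30 * p 2 * z ^ 4 + 30 * p 4 * z ^ 2 + 2 * p 6 + 1 * 6 * p 6 +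
      15 * p 2 * p 4 + 10 * p 3 * p 3 - 32 * p 6 ∧ eval v (u 8) = 2 * 6 * z ^ 8 + 56 * p 2 * z ^ 6 + 140 * p 4 * z ^ 4 + 56 * p 6 * z ^ 2 + 2 * p 8 +
      1 * 6 * p 8 + 28 * p 2 * p 6 + 56 * p 3 * p 5 + 35 * p 4 * p 4 - 128 * p 8 ∧ eval v (u 9) = (-168) * p 3 * z ^ 6 + (-252) * p 5 * z ^ 4 + (-72) * p 7 * z ^ 2 + (-2) * p 9 +
      1 * 6 * p 9 + 36 * p 2 * p 7 + 84 * p 3 * p 6 + 126 * p 4 * p 5 - 256 * p 9 ∧ eval v (u 12) = 2 * 6 * z ^ 12 + 132 * p 2 * z ^ 10 + 990 * p 4 * z ^ 8 + 1848 * p 6 * z ^ 6 +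
      990 * p 8 * z ^ 4 + 132 * p 10 * z ^ 2 + 2 * p 12 + 1 * 6 * p 12 + 66 * p 2 * p 10 +
      220 * p 3 * p 9 + 495 * p 4 * p 8 + 792 * p 5 * p 7 + 462 * p 6 * p 6 - 2048 * p 12 := by
  have p0 : p 0 = 6 := by rw [← hp]; simp only [ps]; norm_num
  have p1 : p 1 = 0 := by rw [← hp]; simp only [ps]; linarith
  have H := fun m => eval_U v m a b c d e f z ha hb hc hd he hz hf
  refine ⟨?_, ?_, ?_, ?_, ?_⟩
  all_goals
    simp only [u, Nat.reduceEqDiff, if_false]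
    rw [H]
  · trans (-10) * p 1 * z ^ 4 + (-20) * p 3 * z ^ 2 + (-2) * p 5 + 1 * p 0 * p 5 + 5 * p 1 * p 4 +
        10 * p 2 * p 3 - 16 * p 5
    · rw [← hp]; simp only [ps]; ring
    · rw [p0, p1]; ring
  · trans 2 * p 0 * z ^ 6 + 30 * p 2 * z ^ 4 + 30 * p 4 * z ^ 2 + 2 * p 6 + 1 * p 0 * p 6 +
        6 * p 1 * p 5 + 15 * p 2 * p 4 + 10 * p 3 * p 3 - 32 * p 6
    · rw [← hp]; simp only [ps]; ring
    · rw [p0, p1]; ring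
  · trans 2 * p 0 * z ^ 8 + 56 * p 2 * z ^ 6 + 140 * p 4 * z ^ 4 + 56 * p 6 * z ^ 2 + 2 * p 8 +
        1 * p 0 * p 8 + 8 * p 1 * p 7 + 28 * p 2 * p 6 + 56 * p 3 * p 5 +
        35 * p 4 * p 4 - 128 * p 8
    · rw [← hp]; simp only [ps]; ring
    · rw [p0, p1]; ring
  · trans (-18) * p 1 * z ^ 8 + (-168) * p 3 * z ^ 6 + (-252) * p 5 * z ^ 4 + (-72) * p 7 * z ^ 2 +
        (-2) * p 9 + 1 * p 0 * p 9 + 9 * p 1 * p 8 + 36 * p 2 * p 7 + 84 * p 3 * p 6 +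
        126 * p 4 * p 5 - 256 * p 9
    · rw [← hp]; simp only [ps]; ring
    · rw [p0, p1]; ring
  · trans 2 * p 0 * z ^ 12 + 132 * p 2 * z ^ 10 + 990 * p 4 * z ^ 8 + 1848 * p 6 * z ^ 6 +
        990 * p 8 * z ^ 4 + 132 * p 10 * z ^ 2 + 2 * p 12 + 1 * p 0 * p 12 + 12 * p 1 * p 11 +
        66 * p 2 * p 10 + 220 * p 3 * p 9 + 495 * p 4 * p 8 + 792 * p 5 * p 7 +
        462 * p 6 * p 6 - 2048 * p 12
    · rw [← hp]; simp only [ps]; ring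
    · rw [p0, p1]; ring

set_option linter.all false in
set_option maxRecDepth 1000000 in
set_option maxHeartbeats 0 in
theorem tE6_eq (k : Fin 6) : tE6 k = aeval ff (TF k) := by
  apply MvPolynomial.funext
  intro v
  obtain ⟨f, hf⟩ : ∃ f, v 0 + v 1 + v 2 + v 3 + v 4 + f = 0 :=
    ⟨-(v 0 + v 1 + v 2 + v 3 + v 4), by ring⟩
  have hu2 : eval v (u 2) = v 5 ^ 2 + 1 / 2 * ps (v 0) (v 1) (v 2) (v 3) (v 4) f 2 := by
    rw [u2_eq, map_add, map_mul, map_pow, eval_C, eval_X,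
      eval_pw v 2 _ _ _ _ _ _ rfl rfl rfl rfl rfl hf]
  obtain ⟨h5, h6, h8, h9, h12⟩ :=
    eval_u v _ _ _ _ _ f _ rfl rfl rfl rfl rfl rfl hf _ rfl
  have hp := fun k hk => ps_eq (v 0) (v 1) (v 2) (v 3) (v 4) f 0 hf k hk
  have h7 := hp 7 (by norm_num)
  have hp8 := hp 8 (by norm_num)
  have hp9 := hp 9 (by norm_num)
  have hp10 := hp 10 (by norm_num)
  have hp12 := hp 12 (by norm_num)
  rw [ff_aeval, eval_aeval', eval_gg v _ _ _ _ _ f _ rfl rfl rfl rfl rfl rfl hf, eval_aeval']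
  rw [h7, hp9] at h9
  rw [hp8] at h8
  rw [h7, hp8, hp9, hp10, hp12] at h12
  clear h7 hp8 hp9 hp10 hp12 hp
  generalize ps (v 0) (v 1) (v 2) (v 3) (v 4) f 2 = p2 at *
  generalize ps (v 0) (v 1) (v 2) (v 3) (v 4) f 3 = p3 at *
  generalize ps (v 0) (v 1) (v 2) (v 3) (v 4) f 4 = p4 at *
  generalize ps (v 0) (v 1) (v 2) (v 3) (v 4) f 5 = p5 at *
  generalize ps (v 0) (v 1) (v 2) (v 3) (v 4) f 6 = p6 at *
  generalize v 5 = z at *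
  simp only [PG, map_add, eval_mo, Matrix.cons_val, pow_zero, pow_one, mul_one] at h8 h9 h12
  fin_cases k
  all_goals as_aux_lemma =>
    simp only [tE6, Matrix.cons_val, Fin.mk_one, Fin.reduceFinMk, Fin.zero_eta, Fin.isValue,
      map_add, map_sub, map_mul, map_pow, eval_C, hu2, h5, h6, h8, h9, h12,
      TF, TF0, TF1, TF2, TF3, TF4, TF5, FG, FG0, FG1, FG2, FG3, FG4, FG5, eval_mo,
      pow_zero, pow_one, mul_one]
    try ring

theorem aeval_TF (Q : MvPolynomial (Fin 5) ℚ) :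
    aeval ff (aeval (fun i : Fin 5 => TF i.castSucc) Q) =
      aeval (fun i : Fin 5 => tE6 i.castSucc) Q := by
  apply MvPolynomial.funext
  intro v
  simp only [eval_aeval', tE6_eq]

theorem pair_tE6 (k l : Fin 6) (h : l ≤ k) :
    pairE6 (tE6 k) (tE6 l) = C (if k.val + l.val = 5 then 24 else 0) * tE6 5 +
      aeval (fun i : Fin 5 => tE6 i.castSucc) (QF l k) := by
  rw [tE6_eq k, tE6_eq l, pair_chain ff MF pair_ff, TF_pair k l h, map_add, map_mul, aeval_TF,
    ← tE6_eq 5, algHom_C, algebraMap_eq]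

theorem deg_iff : ∀ a b : Fin 6, degE6 a + degE6 b = 14 ↔ a.val + b.val = 5 := by
  decide

/-- Each pairing `⟨dt_α, dt_β⟩*` is `c_{αβ} t₁₂` plus a polynomial in
`t₂, t₅, t₆, t₈, t₉`, where `c_{αβ} = 0` unless `α + β = 14`, in which
case `c_{αβ} = 24`. -/
theorem E6_pairings_flat :
    ∀ a b : Fin 6, ∃ (c : ℚ) (Q : MvPolynomial (Fin 5) ℚ),
      pairE6 (tE6 a) (tE6 b) =
        C c * tE6 5 + aeval (fun i : Fin 5 => tE6 i.castSucc) Q ∧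
      (degE6 a + degE6 b ≠ 14 → c = 0) ∧
      (degE6 a + degE6 b = 14 → c = 24) := by
  intro a b
  rcases le_total b a with h | h
  · refine ⟨_, _, pair_tE6 a b h, ?_, ?_⟩
    · intro hd
      exact if_neg (fun h' => hd ((deg_iff a b).2 h'))
    · intro hd
      exact if_pos ((deg_iff a b).1 hd)
  · refine ⟨_, _, (pair_symm _ _).trans (pair_tE6 b a h), ?_, ?_⟩
    · intro hd
      exact if_neg (fun h' => hd ((deg_iff a b).2 ((add_comm _ _).trans h')))
    · intro hd
      exact if_pos ((add_comm _ _).trans ((deg_iff a b).1 hd))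
end
end

section
/- One has the identity ⟨du_5, du_5⟩* = 120 u_8 - 320 u_6 u_2 + 2400 u_2^4 as polynomials in the six variables y. -/
open MvPolynomial

noncomputable section

theorem aux_half : (C (1/2 : ℚ) * (X 5 - -X 5) : MvPolynomial (Fin 6) ℚ) = X 5 := by
  rw [sub_neg_eq_add, ← two_mul, ← mul_assoc, show (2 : MvPolynomial (Fin 6) ℚ) = C 2 from rfl,
    ← C_mul]
  norm_num

theorem aux_S6 : aeval subE6 S6 = 0 := by
  simp [S6, subE6]

/-- The restricted `U_m` written out. -/
theorem aux_U (m : ℕ) : aeval subE6 (U m) =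
    (∑ i : Fin 6, ((X 5 - subE6 (i.castLE (by norm_num))) ^ m
      + (-X 5 - subE6 (i.castLE (by norm_num))) ^ m))
    + ∑ p ∈ Finset.univ.filter (fun p : Fin 6 × Fin 6 => p.1 < p.2),
      (subE6 (p.1.castLE (by norm_num)) + subE6 (p.2.castLE (by norm_num))) ^ m := by
  have h6 : subE6 6 = X 5 := rfl
  have h7 : subE6 7 = - X 5 := rfl
  have hF : (Finset.univ.filter (fun i : Fin 8 => i.val < 6)) =
      Finset.univ.map (Fin.castLEEmb (show 6 ≤ 8 by norm_num)) := by decide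
  have hP : (Finset.univ.filter (fun p : Fin 8 × Fin 8 => p.1.val < p.2.val ∧ p.2.val < 6)) =
      (Finset.univ.filter (fun p : Fin 6 × Fin 6 => p.1 < p.2)).map
        ((Fin.castLEEmb (show 6 ≤ 8 by norm_num)).prodMap
          (Fin.castLEEmb (show 6 ≤ 8 by norm_num))) := by decide
  have hC : ∀ r : ℚ, aeval subE6 (C r) = (C r : MvPolynomial (Fin 6) ℚ) := fun r => by
    rw [aeval_C]; rfl
  unfold U
  rw [hF, hP, Finset.sum_map, Finset.sum_map]
  simp only [map_add, map_sum, map_pow, map_sub, map_mul, map_neg, aux_S6, aeval_X, hC, h6, h7,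
    aux_half, mul_zero, add_zero, sub_zero]
  rfl

theorem aux_pairs : (Finset.univ.filter (fun p : Fin 6 × Fin 6 => p.1 < p.2)) =
    {(0,1),(0,2),(0,3),(0,4),(0,5),(1,2),(1,3),(1,4),(1,5),(2,3),(2,4),(2,5),(3,4),(3,5),(4,5)} := by
  decide

/-- The function of seven numbers underlying `U_m`. -/
def V {R : Type*} [CommRing R] (m : ℕ) (a b c d e f t : R) : R :=
  (t - a) ^ m + (-t - a) ^ m + ((t - b) ^ m + (-t - b) ^ m) + ((t - c) ^ m + (-t - c) ^ m)
  + ((t - d) ^ m + (-t - d) ^ m) + ((t - e) ^ m + (-t - e) ^ m) + ((t - f) ^ m + (-t - f) ^ m)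
  + ((a + b) ^ m + (a + c) ^ m + (a + d) ^ m + (a + e) ^ m + (a + f) ^ m
  + (b + c) ^ m + (b + d) ^ m + (b + e) ^ m + (b + f) ^ m
  + (c + d) ^ m + (c + e) ^ m + (c + f) ^ m + (d + e) ^ m + (d + f) ^ m + (e + f) ^ m)

theorem aux_UV (m : ℕ) : aeval subE6 (U m) =
    V m (X 0) (X 1) (X 2) (X 3) (X 4) (-(X 0 + X 1 + X 2 + X 3 + X 4)) (X 5) := by
  have h0 : subE6 ((0 : Fin 6).castLE (by norm_num)) = X 0 := rfl
  have h1 : subE6 ((1 : Fin 6).castLE (by norm_num)) = X 1 := rfl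
  have h2 : subE6 ((2 : Fin 6).castLE (by norm_num)) = X 2 := rfl
  have h3 : subE6 ((3 : Fin 6).castLE (by norm_num)) = X 3 := rfl
  have h4 : subE6 ((4 : Fin 6).castLE (by norm_num)) = X 4 := rfl
  have h5 : subE6 ((5 : Fin 6).castLE (by norm_num)) = -(X 0 + X 1 + X 2 + X 3 + X 4) := rfl
  rw [aux_U, aux_pairs, Fin.sum_univ_six]
  iterate 14 rw [Finset.sum_insert (by decide)]
  rw [Finset.sum_singleton]
  simp only [h0, h1, h2, h3, h4, h5, V]
  ring

theorem aux_V2 {R : Type*} [CommRing R] (a b c d e t : R) :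
    V 2 a b c d e (-(a + b + c + d + e)) t = 12 * (t * t + (a * a + b * b + c * c + d * d + e * e
      + a * b + a * c + a * d + a * e + b * c + b * d + b * e + c * d + c * e + d * e)) := by
  unfold V; ring

theorem aux_u2 : u 2 = (X 5 * X 5 + (X 0 * X 0 + X 1 * X 1 + X 2 * X 2 + X 3 * X 3 + X 4 * X 4
      + X 0 * X 1 + X 0 * X 2 + X 0 * X 3 + X 0 * X 4 + X 1 * X 2 + X 1 * X 3 + X 1 * X 4
      + X 2 * X 3 + X 2 * X 4 + X 3 * X 4)) := by
  rw [u, if_pos rfl, aux_UV, aux_V2, ← mul_assoc,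
    show (12 : MvPolynomial (Fin 6) ℚ) = C 12 from rfl, ← C_mul]
  norm_num

theorem aux_XX (i j : Fin 6) : (X i * X j : MvPolynomial (Fin 6) ℚ) =
    monomial (Finsupp.single i 1 + Finsupp.single j 1) 1 := by
  simp [X, monomial_mul]

theorem aux_single (i : Fin 6) : (Finsupp.single i 2 : Fin 6 →₀ ℕ) =
    Finsupp.single i 1 + Finsupp.single i 1 := by
  rw [← Finsupp.single_add]

theorem aux_coeff (i j k l : Fin 6) :
    coeff (Finsupp.single i 1 + Finsupp.single j 1) (X k * X l : MvPolynomial (Fin 6) ℚ)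
      = if (i = k ∧ j = l) ∨ (i = l ∧ j = k) then 1 else 0 := by
  rw [aux_XX, coeff_monomial]
  congr 1
  rw [eq_iff_iff]
  constructor
  · intro h
    have := congrArg Finsupp.toMultiset h
    simp only [map_add, Finsupp.toMultiset_single, one_smul] at this
    have h2 : ({k, l} : Multiset (Fin 6)) = {i, j} := this
    clear this h
    revert h2; revert i j k l; decide
  · rintro (⟨rfl, rfl⟩ | ⟨rfl, rfl⟩)
    · rfl
    · exact add_comm _ _

theorem aux_G : GE6 = !![1,1/2,1/2,1/2,1/2,0; 1/2,1,1/2,1/2,1/2,0; 1/2,1/2,1,1/2,1/2,0;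
    1/2,1/2,1/2,1,1/2,0; 1/2,1/2,1/2,1/2,1,0; 0,0,0,0,0,1] := by
  ext i j
  unfold GE6
  rw [aux_u2, aux_single]
  simp only [coeff_add, aux_coeff]
  fin_cases i <;> fin_cases j <;> norm_num [Fin.ext_iff]

theorem aux_Ginv : GE6⁻¹ = !![5/3,-1/3,-1/3,-1/3,-1/3,0; -1/3,5/3,-1/3,-1/3,-1/3,0;
    -1/3,-1/3,5/3,-1/3,-1/3,0; -1/3,-1/3,-1/3,5/3,-1/3,0; -1/3,-1/3,-1/3,-1/3,5/3,0;
    0,0,0,0,0,1] := by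
  apply Matrix.inv_eq_right_inv
  rw [aux_G]
  decide +kernel

theorem aux_V5 {R : Type*} [CommRing R] (a b c d e f t : R) (h : f = -(a + b + c + d + e)) :
    V 5 a b c d e f t = -12 * (a ^ 5 + b ^ 5 + c ^ 5 + d ^ 5 + e ^ 5 + f ^ 5)
      - 20 * t ^ 2 * (a ^ 3 + b ^ 3 + c ^ 3 + d ^ 3 + e ^ 3 + f ^ 3)
      + 10 * (a ^ 2 + b ^ 2 + c ^ 2 + d ^ 2 + e ^ 2 + f ^ 2)
        * (a ^ 3 + b ^ 3 + c ^ 3 + d ^ 3 + e ^ 3 + f ^ 3) := by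
  unfold V; linear_combination (5 * (a ^ 4 + b ^ 4 + c ^ 4 + d ^ 4 + e ^ 4 + f ^ 4) - 10 * t ^ 4) * h

theorem aux_V6 {R : Type*} [CommRing R] (a b c d e f t : R) (h : f = -(a + b + c + d + e)) :
    V 6 a b c d e f t = -24 * (a ^ 6 + b ^ 6 + c ^ 6 + d ^ 6 + e ^ 6 + f ^ 6)
      + 12 * t ^ 6 + 30 * t ^ 4 * (a ^ 2 + b ^ 2 + c ^ 2 + d ^ 2 + e ^ 2 + f ^ 2)
      + 30 * t ^ 2 * (a ^ 4 + b ^ 4 + c ^ 4 + d ^ 4 + e ^ 4 + f ^ 4)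
      + 15 * (a ^ 2 + b ^ 2 + c ^ 2 + d ^ 2 + e ^ 2 + f ^ 2)
        * (a ^ 4 + b ^ 4 + c ^ 4 + d ^ 4 + e ^ 4 + f ^ 4)
      + 10 * (a ^ 3 + b ^ 3 + c ^ 3 + d ^ 3 + e ^ 3 + f ^ 3) ^ 2 := by
  unfold V; linear_combination (6 * (a ^ 5 + b ^ 5 + c ^ 5 + d ^ 5 + e ^ 5 + f ^ 5)) * h

theorem aux_V8 {R : Type*} [CommRing R] (a b c d e f t : R) (h : f = -(a + b + c + d + e)) :
    V 8 a b c d e f t = -120 * (a ^ 8 + b ^ 8 + c ^ 8 + d ^ 8 + e ^ 8 + f ^ 8)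
      + 12 * t ^ 8 + 56 * t ^ 6 * (a ^ 2 + b ^ 2 + c ^ 2 + d ^ 2 + e ^ 2 + f ^ 2)
      + 140 * t ^ 4 * (a ^ 4 + b ^ 4 + c ^ 4 + d ^ 4 + e ^ 4 + f ^ 4)
      + 56 * t ^ 2 * (a ^ 6 + b ^ 6 + c ^ 6 + d ^ 6 + e ^ 6 + f ^ 6)
      + 28 * (a ^ 2 + b ^ 2 + c ^ 2 + d ^ 2 + e ^ 2 + f ^ 2)
        * (a ^ 6 + b ^ 6 + c ^ 6 + d ^ 6 + e ^ 6 + f ^ 6)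
      + 56 * (a ^ 3 + b ^ 3 + c ^ 3 + d ^ 3 + e ^ 3 + f ^ 3)
        * (a ^ 5 + b ^ 5 + c ^ 5 + d ^ 5 + e ^ 5 + f ^ 5)
      + 35 * (a ^ 4 + b ^ 4 + c ^ 4 + d ^ 4 + e ^ 4 + f ^ 4) ^ 2 := by
  unfold V; linear_combination (8 * (a ^ 7 + b ^ 7 + c ^ 7 + d ^ 7 + e ^ 7 + f ^ 7)) * h

theorem aux_newton (a b c d e f : ℚ) (h : f = -(a + b + c + d + e))
    (p2 p3 p4 p5 p6 p8 : ℚ)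
    (h2 : a ^ 2 + b ^ 2 + c ^ 2 + d ^ 2 + e ^ 2 + f ^ 2 = p2)
    (h3 : a ^ 3 + b ^ 3 + c ^ 3 + d ^ 3 + e ^ 3 + f ^ 3 = p3)
    (h4 : a ^ 4 + b ^ 4 + c ^ 4 + d ^ 4 + e ^ 4 + f ^ 4 = p4)
    (h5 : a ^ 5 + b ^ 5 + c ^ 5 + d ^ 5 + e ^ 5 + f ^ 5 = p5)
    (h6 : a ^ 6 + b ^ 6 + c ^ 6 + d ^ 6 + e ^ 6 + f ^ 6 = p6)
    (h8 : a ^ 8 + b ^ 8 + c ^ 8 + d ^ 8 + e ^ 8 + f ^ 8 = p8) :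
    ∃ e2 e3 e4 e5 e6 : ℚ, p2 = -2 * e2 ∧ p3 = 3 * e3 ∧ p4 = 2 * e2 ^ 2 - 4 * e4 ∧
      p5 = -5 * e2 * e3 + 5 * e5 ∧ p6 = -e2 * p4 + e3 * p3 - e4 * p2 - 6 * e6 ∧
      p8 = -e2 * p6 + e3 * p5 - e4 * p4 + e5 * p3 - e6 * p2 := by
  -- elementary symmetric functions of `a, …, e`
  obtain ⟨s1, hs1⟩ : ∃ s, s = a + b + c + d + e := ⟨_, rfl⟩
  obtain ⟨s2, hs2⟩ : ∃ s, s = a*b + a*c + a*d + a*e + b*c + b*d + b*e + c*d + c*e + d*e :=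
    ⟨_, rfl⟩
  obtain ⟨s3, hs3⟩ : ∃ s, s = a*b*c + a*b*d + a*b*e + a*c*d + a*c*e + a*d*e + b*c*d + b*c*e
    + b*d*e + c*d*e := ⟨_, rfl⟩
  obtain ⟨s4, hs4⟩ : ∃ s, s = a*b*c*d + a*b*c*e + a*b*d*e + a*c*d*e + b*c*d*e := ⟨_, rfl⟩
  obtain ⟨s5, hs5⟩ : ∃ s, s = a*b*c*d*e := ⟨_, rfl⟩
  have key : ∀ x : ℚ, (x - a) * (x - b) * (x - c) * (x - d) * (x - e) * (x - f) =
      x ^ 6 + (s2 + f * s1) * x ^ 4 - (s3 + f * s2) * x ^ 3 + (s4 + f * s3) * x ^ 2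
        - (s5 + f * s4) * x + f * s5 := by
    intro x
    have : (x - a) * (x - b) * (x - c) * (x - d) * (x - e) =
      x ^ 5 - s1 * x ^ 4 + s2 * x ^ 3 - s3 * x ^ 2 + s4 * x - s5 := by
      rw [hs1, hs2, hs3, hs4, hs5]; ring
    rw [this, h, ← hs1]; ring
  have r2 : p2 = -2 * (s2 + f * s1) := by
    rw [← h2, h, hs2, hs1]; ring
  have r3 : p3 = 3 * (s3 + f * s2) := by
    rw [← h3, h, hs2, hs3]; ring
  have r4 : p4 = 2 * (s2 + f * s1) ^ 2 - 4 * (s4 + f * s3) := by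
    rw [← h4, h, hs2, hs3, hs4, hs1]; ring
  have r5 : p5 = -5 * (s2 + f * s1) * (s3 + f * s2) + 5 * (s5 + f * s4) := by
    rw [← h5, h, hs2, hs3, hs4, hs5, hs1]; ring
  have ka := key a
  have kb := key b
  have kc := key c
  have kd := key d
  have ke := key e
  have kf := key f
  simp only [sub_self, mul_zero, zero_mul] at ka kb kc kd ke kf
  generalize s2 + f * s1 = e2 at *
  generalize s3 + f * s2 = e3 at *
  generalize s4 + f * s3 = e4 at *
  generalize s5 + f * s4 = e5 at *
  generalize f * s5 = e6 at *
  refine ⟨e2, e3, e4, e5, e6, r2, r3, r4, r5, ?_, ?_⟩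
  · rw [← h6, ← h4, ← h3, ← h2]
    linear_combination -ka - kb - kc - kd - ke - kf + e5 * h
  · rw [← h8, ← h6, ← h5, ← h4, ← h3, ← h2]
    linear_combination -a^2*ka - b^2*kb - c^2*kc - d^2*kd - e^2*ke - f^2*kf

theorem aux_main (a b c d e f t : ℚ) (h : f = -(a + b + c + d + e))
    (p2 p3 p4 p5 p6 p8 : ℚ)
    (h2 : a ^ 2 + b ^ 2 + c ^ 2 + d ^ 2 + e ^ 2 + f ^ 2 = p2)
    (h3 : a ^ 3 + b ^ 3 + c ^ 3 + d ^ 3 + e ^ 3 + f ^ 3 = p3)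
    (h4 : a ^ 4 + b ^ 4 + c ^ 4 + d ^ 4 + e ^ 4 + f ^ 4 = p4)
    (h5 : a ^ 5 + b ^ 5 + c ^ 5 + d ^ 5 + e ^ 5 + f ^ 5 = p5)
    (h6 : a ^ 6 + b ^ 6 + c ^ 6 + d ^ 6 + e ^ 6 + f ^ 6 = p6)
    (h8 : a ^ 8 + b ^ 8 + c ^ 8 + d ^ 8 + e ^ 8 + f ^ 8 = p8)
    (g : ℚ → ℚ) (hg : ∀ x, g x = -60 * x ^ 4 - 60 * t ^ 2 * x ^ 2 + 20 * p3 * x + 30 * p2 * x ^ 2) :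
    (-40 * t * p3) ^ 2 + 2 * (g a ^ 2 + g b ^ 2 + g c ^ 2 + g d ^ 2 + g e ^ 2 + g f ^ 2
      - (g a + g b + g c + g d + g e + g f) ^ 2 / 6) =
    120 * (-120 * p8 + 12 * t ^ 8 + 56 * t ^ 6 * p2 + 140 * t ^ 4 * p4 + 56 * t ^ 2 * p6
      + 28 * p2 * p6 + 56 * p3 * p5 + 35 * p4 ^ 2)
    - 320 * (-24 * p6 + 12 * t ^ 6 + 30 * t ^ 4 * p2 + 30 * t ^ 2 * p4 + 15 * p2 * p4
      + 10 * p3 ^ 2) * (t ^ 2 + p2 / 2) + 2400 * (t ^ 2 + p2 / 2) ^ 4 := by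
  have hs : g a + g b + g c + g d + g e + g f = -60 * p4 - 60 * t ^ 2 * p2 + 30 * p2 * p2 := by
    simp only [hg]
    linear_combination -60 * h4 - 60 * t ^ 2 * h2 + 30 * p2 * h2 + 20 * p3 * h
  have hq : g a ^ 2 + g b ^ 2 + g c ^ 2 + g d ^ 2 + g e ^ 2 + g f ^ 2 =
      3600 * p8 + (30 * p2 - 60 * t ^ 2) ^ 2 * p4 + 400 * p3 ^ 2 * p2
      - 120 * (30 * p2 - 60 * t ^ 2) * p6 - 2400 * p3 * p5
      + 40 * p3 * (30 * p2 - 60 * t ^ 2) * p3 := by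
    simp only [hg]
    linear_combination 3600 * h8 + (30 * p2 - 60 * t ^ 2) ^ 2 * h4 + 400 * p3 ^ 2 * h2
      - 120 * (30 * p2 - 60 * t ^ 2) * h6 - 2400 * p3 * h5
      + 40 * p3 * (30 * p2 - 60 * t ^ 2) * h3
  obtain ⟨e2, e3, e4, e5, e6, r2, r3, r4, r5, r6, r8⟩ :=
    aux_newton a b c d e f h p2 p3 p4 p5 p6 p8 h2 h3 h4 h5 h6 h8
  rw [hs, hq, r8, r6, r5, r4, r3, r2]
  ring

theorem aux_quad (ga gb gc gd ge gf gt : ℚ) :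
    gt ^ 2 + 2 * (ga ^ 2 + gb ^ 2 + gc ^ 2 + gd ^ 2 + ge ^ 2 + gf ^ 2
      - (ga + gb + gc + gd + ge + gf) ^ 2 / 6) =
    ∑ i : Fin 6, ∑ j : Fin 6, (!![5/3,-1/3,-1/3,-1/3,-1/3,0; -1/3,5/3,-1/3,-1/3,-1/3,0;
    -1/3,-1/3,5/3,-1/3,-1/3,0; -1/3,-1/3,-1/3,5/3,-1/3,0; -1/3,-1/3,-1/3,-1/3,5/3,0;
    0,0,0,0,0,1] : Matrix (Fin 6) (Fin 6) ℚ) i j *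
      ![ga - gf, gb - gf, gc - gf, gd - gf, ge - gf, gt] i *
      ![ga - gf, gb - gf, gc - gf, gd - gf, ge - gf, gt] j := by
  simp [Fin.sum_univ_six]
  ring

theorem aux_pderiv (D : Derivation ℚ (MvPolynomial (Fin 6) ℚ) (MvPolynomial (Fin 6) ℚ))
    (a b c d e f t : MvPolynomial (Fin 6) ℚ) :
    D (-12 * (a ^ 5 + b ^ 5 + c ^ 5 + d ^ 5 + e ^ 5 + f ^ 5)
      - 20 * t ^ 2 * (a ^ 3 + b ^ 3 + c ^ 3 + d ^ 3 + e ^ 3 + f ^ 3)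
      + 10 * (a ^ 2 + b ^ 2 + c ^ 2 + d ^ 2 + e ^ 2 + f ^ 2)
        * (a ^ 3 + b ^ 3 + c ^ 3 + d ^ 3 + e ^ 3 + f ^ 3)) =
    -60 * (a ^ 4 * D a + b ^ 4 * D b + c ^ 4 * D c + d ^ 4 * D d + e ^ 4 * D e + f ^ 4 * D f)
    + (30 * (a ^ 2 + b ^ 2 + c ^ 2 + d ^ 2 + e ^ 2 + f ^ 2) - 60 * t ^ 2) *
      (a ^ 2 * D a + b ^ 2 * D b + c ^ 2 * D c + d ^ 2 * D d + e ^ 2 * D e + f ^ 2 * D f)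
    + 20 * (a ^ 3 + b ^ 3 + c ^ 3 + d ^ 3 + e ^ 3 + f ^ 3) *
      (a * D a + b * D b + c * D c + d * D d + e * D e + f * D f)
    - 40 * t * (a ^ 3 + b ^ 3 + c ^ 3 + d ^ 3 + e ^ 3 + f ^ 3) * D t := by
  have n12 : D (-12) = 0 := by
    rw [map_neg, neg_eq_zero]; exact D.map_algebraMap 12
  have n20 : D 20 = 0 := D.map_algebraMap 20
  have n10 : D 10 = 0 := D.map_algebraMap 10
  simp only [map_add, map_sub, Derivation.leibniz, Derivation.leibniz_pow, n12, n20, n10,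
    smul_eq_mul, nsmul_eq_mul, mul_zero, add_zero]
  push_cast
  ring

/-- `⟨du₅, du₅⟩* = 120 u₈ - 320 u₆ u₂ + 2400 u₂⁴`. -/
theorem E6_pair_u5_u5 :
    pairE6 (u 5) (u 5) =
      C (120 : ℚ) * u 8 - C (320 : ℚ) * u 6 * u 2 + C (2400 : ℚ) * u 2 ^ 4 := by
  have h5 : u 5 = _ := (if_neg (by norm_num)).trans ((aux_UV 5).trans (aux_V5 _ _ _ _ _ _ _ rfl))
  have h6 : u 6 = _ := (if_neg (by norm_num)).trans ((aux_UV 6).trans (aux_V6 _ _ _ _ _ _ _ rfl))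
  have h8 : u 8 = _ := (if_neg (by norm_num)).trans ((aux_UV 8).trans (aux_V8 _ _ _ _ _ _ _ rfl))
  apply MvPolynomial.funext
  intro y
  obtain ⟨f, hf⟩ : ∃ f, f = -(y 0 + y 1 + y 2 + y 3 + y 4) := ⟨_, rfl⟩
  obtain ⟨p2, h2⟩ : ∃ p, y 0 ^ 2 + y 1 ^ 2 + y 2 ^ 2 + y 3 ^ 2 + y 4 ^ 2 + f ^ 2 = p := ⟨_, rfl⟩
  obtain ⟨p3, h3⟩ : ∃ p, y 0 ^ 3 + y 1 ^ 3 + y 2 ^ 3 + y 3 ^ 3 + y 4 ^ 3 + f ^ 3 = p := ⟨_, rfl⟩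
  obtain ⟨g, hg⟩ : ∃ g : ℚ → ℚ, ∀ x, g x = -60 * x ^ 4 - 60 * y 5 ^ 2 * x ^ 2 + 20 * p3 * x
    + 30 * p2 * x ^ 2 := ⟨_, fun _ => rfl⟩
  have main := aux_main (y 0) (y 1) (y 2) (y 3) (y 4) f (y 5) hf p2 p3 _ _ _ _ h2 h3 rfl rfl rfl
    rfl g hg
  have hX : ∀ i, eval y (X i) = y i := fun i => eval_X i
  have hu2 : eval y (u 2) = y 5 ^ 2 + p2 / 2 := by
    rw [aux_u2, ← h2, hf]
    simp only [map_add, map_mul, hX]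
    ring
  have hd : ∀ i, eval y (pderiv i (u 5)) = ![g (y 0) - g f, g (y 1) - g f, g (y 2) - g f,
      g (y 3) - g f, g (y 4) - g f, -40 * y 5 * p3] i := by
    intro i
    rw [h5, aux_pderiv]
    have n60 : eval y (-60) = -60 := by
      rw [map_neg]; exact congrArg Neg.neg (eval_C 60)
    have n20 : eval y 20 = 20 := eval_C 20
    have n30 : eval y 30 = 30 := eval_C 30
    have n40 : eval y 40 = 40 := eval_C 40
    have n60' : eval y 60 = 60 := eval_C 60
    simp only [map_add, map_mul, map_sub, map_neg, map_pow, hX, n60, n20, n30, n40, n60', pderiv_X,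
      ← hf, h2, h3]
    fin_cases i <;> simp [hg, Pi.single_apply] <;> ring
  rw [aux_quad] at main
  rw [pairE6, aux_Ginv]
  simp only [map_sum, map_mul, map_sub, map_add, map_pow, eval_C, hd, hu2, main]
  rw [h6, h8]
  have n1 : eval y (-24) = -24 := by
      rw [map_neg]; exact congrArg Neg.neg (eval_C 24)
  have n2 : eval y 12 = 12 := eval_C 12
  have n3 : eval y 30 = 30 := eval_C 30
  have n4 : eval y 15 = 15 := eval_C 15
  have n5 : eval y 10 = 10 := eval_C 10
  have n6 : eval y (-120) = -120 := by
      rw [map_neg]; exact congrArg Neg.neg (eval_C 120)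
  have n7 : eval y 56 = 56 := eval_C 56
  have n8 : eval y 140 = 140 := eval_C 140
  have n9 : eval y 28 = 28 := eval_C 28
  have n10 : eval y 35 = 35 := eval_C 35
  simp only [map_add, map_mul, map_sub, map_neg, map_pow, hX, n1, n2, n3, n4, n5, n6, n7, n8, n9,
    n10, ← hf, h2, h3]
end
end

section
/- One has the identity ⟨du_6, du_6⟩* = 144 u_8 u_2 + 576 u_6 u_2^2 + (48/5) u_5^2 - 3456 u_2^5 as polynomials in the six variables y. -/
open MvPolynomial

noncomputable section

/-- The sum of the `m`-th powers of the 27 linear forms. -/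
def WE6 {R : Type*} [CommRing R] (a b c d e f t : R) (m : ℕ) : R :=
  ((t - a) ^ m + (-t - a) ^ m) +
  ((t - b) ^ m + (-t - b) ^ m) +
  ((t - c) ^ m + (-t - c) ^ m) +
  ((t - d) ^ m + (-t - d) ^ m) +
  ((t - e) ^ m + (-t - e) ^ m) +
  ((t - f) ^ m + (-t - f) ^ m) +
  (a + b) ^ m + (a + c) ^ m + (a + d) ^ m + (a + e) ^ m + (a + f) ^ m +
  (b + c) ^ m + (b + d) ^ m + (b + e) ^ m + (b + f) ^ m +
  (c + d) ^ m + (c + e) ^ m + (c + f) ^ m +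
  (d + e) ^ m + (d + f) ^ m +
  (e + f) ^ m

/-- The common shape of the derivative of the sixth power sum along `x_i`. -/
def gE6 (t p2 p3 p4 p5 z : ℚ) : ℚ :=
  6 * (-24 * z^5 + 20 * z^3 * t^2 + 10 * z * t^4 + 10 * z^3 * p2 + 10 * z^2 * p3 + 5 * z * p4 + p5)

lemma aeval_U (m : ℕ) : aeval subE6 (U m) =
    WE6 (X 0) (X 1) (X 2) (X 3) (X 4) (-(X 0 + X 1 + X 2 + X 3 + X 4)) (X 5) m := by
  have hS : aeval subE6 S6 = 0 := by
    simp [S6, subE6]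
  have hT : C (1/2 : ℚ) * (X 5 - -X 5) = (X 5 : MvPolynomial (Fin 6) ℚ) := by
    rw [sub_neg_eq_add, ← two_mul, ← mul_assoc, show (2 : MvPolynomial (Fin 6) ℚ) = C 2 from rfl,
      ← C_mul]
    norm_num
  have hTT : aeval subE6 (C (1/2 : ℚ) * (X 6 - X 7)) = (X 5 : MvPolynomial (Fin 6) ℚ) := by
    rw [map_mul, map_sub, aeval_X, aeval_X]
    simpa [subE6, algebraMap_eq] using hT
  rw [U, map_add, map_sum, map_sum, Finset.sum_filter, Finset.sum_filter, Fintype.sum_prod_type]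
  simp only [map_add, map_sub, map_pow, map_neg, hTT, map_mul _ _ S6, hS, mul_zero, add_zero,
    sub_zero, aeval_X]
  simp [Fin.sum_univ_succ, subE6, WE6]
  ring

lemma eval_WE6 (y : Fin 6 → ℚ) (a b c d e f t : MvPolynomial (Fin 6) ℚ) (m : ℕ) :
    eval y (WE6 a b c d e f t m) =
      WE6 (eval y a) (eval y b) (eval y c) (eval y d) (eval y e) (eval y f) (eval y t) m := by
  simp [WE6]

/-- Power sums of six numbers. -/
def psE6 (a b c d e f : ℚ) (k : ℕ) : ℚ := a^k + b^k + c^k + d^k + e^k + f^k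

/-- The derivative of the sixth power sum along `x_i`, up to a common shift. -/
def gyE6 (a b c d e f t z : ℚ) : ℚ :=
  gE6 t (psE6 a b c d e f 2) (psE6 a b c d e f 3) (psE6 a b c d e f 4) (psE6 a b c d e f 5) z

lemma eval_pderiv0 (y : Fin 6 → ℚ) : eval y (pderiv 0 (u 6)) =
    gyE6 (y 0) (y 1) (y 2) (y 3) (y 4) (-(y 0 + y 1 + y 2 + y 3 + y 4)) (y 5) (y 0) -
    gyE6 (y 0) (y 1) (y 2) (y 3) (y 4) (-(y 0 + y 1 + y 2 + y 3 + y 4)) (y 5) (-(y 0 + y 1 + y 2 + y 3 + y 4)) := by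
  rw [u, if_neg (by norm_num), aeval_U]
  simp [WE6]
  simp only [gyE6, gE6, psE6]
  ring

lemma eval_pderiv1 (y : Fin 6 → ℚ) : eval y (pderiv 1 (u 6)) =
    gyE6 (y 0) (y 1) (y 2) (y 3) (y 4) (-(y 0 + y 1 + y 2 + y 3 + y 4)) (y 5) (y 1) -
    gyE6 (y 0) (y 1) (y 2) (y 3) (y 4) (-(y 0 + y 1 + y 2 + y 3 + y 4)) (y 5) (-(y 0 + y 1 + y 2 + y 3 + y 4)) := by
  rw [u, if_neg (by norm_num), aeval_U]
  simp [WE6]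
  simp only [gyE6, gE6, psE6]
  ring

lemma eval_pderiv2 (y : Fin 6 → ℚ) : eval y (pderiv 2 (u 6)) =
    gyE6 (y 0) (y 1) (y 2) (y 3) (y 4) (-(y 0 + y 1 + y 2 + y 3 + y 4)) (y 5) (y 2) -
    gyE6 (y 0) (y 1) (y 2) (y 3) (y 4) (-(y 0 + y 1 + y 2 + y 3 + y 4)) (y 5) (-(y 0 + y 1 + y 2 + y 3 + y 4)) := by
  rw [u, if_neg (by norm_num), aeval_U]
  simp [WE6]
  simp only [gyE6, gE6, psE6]
  ring

lemma eval_pderiv3 (y : Fin 6 → ℚ) : eval y (pderiv 3 (u 6)) =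
    gyE6 (y 0) (y 1) (y 2) (y 3) (y 4) (-(y 0 + y 1 + y 2 + y 3 + y 4)) (y 5) (y 3) -
    gyE6 (y 0) (y 1) (y 2) (y 3) (y 4) (-(y 0 + y 1 + y 2 + y 3 + y 4)) (y 5) (-(y 0 + y 1 + y 2 + y 3 + y 4)) := by
  rw [u, if_neg (by norm_num), aeval_U]
  simp [WE6]
  simp only [gyE6, gE6, psE6]
  ring

lemma eval_pderiv4 (y : Fin 6 → ℚ) : eval y (pderiv 4 (u 6)) =
    gyE6 (y 0) (y 1) (y 2) (y 3) (y 4) (-(y 0 + y 1 + y 2 + y 3 + y 4)) (y 5) (y 4) -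
    gyE6 (y 0) (y 1) (y 2) (y 3) (y 4) (-(y 0 + y 1 + y 2 + y 3 + y 4)) (y 5) (-(y 0 + y 1 + y 2 + y 3 + y 4)) := by
  rw [u, if_neg (by norm_num), aeval_U]
  simp [WE6]
  simp only [gyE6, gE6, psE6]
  ring

lemma eval_pderiv5 (y : Fin 6 → ℚ) : eval y (pderiv 5 (u 6)) =
    6 * (12 * (y 5)^5 + 20 * (y 5)^3 * psE6 (y 0) (y 1) (y 2) (y 3) (y 4) (-(y 0 + y 1 + y 2 + y 3 + y 4)) 2 +
      10 * y 5 * psE6 (y 0) (y 1) (y 2) (y 3) (y 4) (-(y 0 + y 1 + y 2 + y 3 + y 4)) 4) := by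
  rw [u, if_neg (by norm_num), aeval_U]
  simp [WE6]
  simp only [psE6]
  ring

lemma GE6_eq_s16 (i j : Fin 6) :
    GE6 i j = (1/2) * constantCoeff (pderiv i (pderiv j (u 2))) := by
  rw [constantCoeff_eq, coeff_pderiv, coeff_pderiv, GE6]
  by_cases h : i = j
  · subst h
    rw [if_pos rfl, zero_add, ← Finsupp.single_add]
    simp
    norm_num
    ring
  · rw [if_neg h]
    simp [h]

set_option maxHeartbeats 4000000 in
lemma GE6_val : GE6 = !![1, 1/2, 1/2, 1/2, 1/2, 0; 1/2, 1, 1/2, 1/2, 1/2, 0;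
    1/2, 1/2, 1, 1/2, 1/2, 0; 1/2, 1/2, 1/2, 1, 1/2, 0; 1/2, 1/2, 1/2, 1/2, 1, 0;
    0, 0, 0, 0, 0, 1] := by
  have hc : constantCoeff (2 : MvPolynomial (Fin 6) ℚ) = 2 := map_ofNat _ 2
  ext i j
  rw [GE6_eq_s16, u, if_pos rfl, aeval_U]
  fin_cases i <;> fin_cases j <;> simp [WE6, hc] <;> norm_num

lemma GE6_inv_s16 : GE6⁻¹ = !![5/3, -1/3, -1/3, -1/3, -1/3, 0; -1/3, 5/3, -1/3, -1/3, -1/3, 0;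
    -1/3, -1/3, 5/3, -1/3, -1/3, 0; -1/3, -1/3, -1/3, 5/3, -1/3, 0;
    -1/3, -1/3, -1/3, -1/3, 5/3, 0; 0, 0, 0, 0, 0, 1] := by
  apply Matrix.inv_eq_right_inv
  rw [GE6_val]
  ext i j
  fin_cases i <;> fin_cases j <;> simp [Matrix.mul_apply, Fin.sum_univ_succ] <;> norm_num

/-- The pairing on the hyperplane in terms of the six ambient derivatives. -/
lemma quad_E6 (a b c d e f w : ℚ) (v : Fin 6 → ℚ) (h0 : v 0 = a - f) (h1 : v 1 = b - f)
    (h2 : v 2 = c - f) (h3 : v 3 = d - f) (h4 : v 4 = e - f) (h5 : v 5 = w) :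
    ∑ i : Fin 6, ∑ j : Fin 6, GE6⁻¹ i j * v i * v j =
      w^2 + 2 * (a^2 + b^2 + c^2 + d^2 + e^2 + f^2) - (a + b + c + d + e + f)^2 / 3 := by
  rw [GE6_inv_s16]
  simp [Fin.sum_univ_six, h0, h1, h2, h3, h4, h5]
  ring

lemma sum_gE6 (a b c d e f t p2 p3 p4 p5 : ℚ) :
    gE6 t p2 p3 p4 p5 a + gE6 t p2 p3 p4 p5 b + gE6 t p2 p3 p4 p5 c + gE6 t p2 p3 p4 p5 d +
      gE6 t p2 p3 p4 p5 e + gE6 t p2 p3 p4 p5 f =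
    6 * (-24 * psE6 a b c d e f 5 + (20 * t^2 + 10 * p2) * psE6 a b c d e f 3
      + 10 * p3 * psE6 a b c d e f 2 + (10 * t^4 + 5 * p4) * psE6 a b c d e f 1 + 6 * p5) := by
  simp only [gE6, psE6]
  ring

lemma sum_gE6_sq (a b c d e f t p2 p3 p4 p5 B D : ℚ) (hB : B = 20 * t^2 + 10 * p2)
    (hD : D = 10 * t^4 + 5 * p4) :
    gE6 t p2 p3 p4 p5 a ^ 2 + gE6 t p2 p3 p4 p5 b ^ 2 + gE6 t p2 p3 p4 p5 c ^ 2 +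
      gE6 t p2 p3 p4 p5 d ^ 2 + gE6 t p2 p3 p4 p5 e ^ 2 + gE6 t p2 p3 p4 p5 f ^ 2 =
    36 * (576 * psE6 a b c d e f 10 - 48 * B * psE6 a b c d e f 8
      - 480 * p3 * psE6 a b c d e f 7 + (B^2 - 48 * D) * psE6 a b c d e f 6
      + (20 * B * p3 - 48 * p5) * psE6 a b c d e f 5
      + (2 * B * D + 100 * p3^2) * psE6 a b c d e f 4
      + (2 * B * p5 + 20 * p3 * D) * psE6 a b c d e f 3
      + (20 * p3 * p5 + D^2) * psE6 a b c d e f 2 + 2 * D * p5 * psE6 a b c d e f 1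
      + 6 * p5^2) := by
  have key : ∀ z, gE6 t p2 p3 p4 p5 z ^ 2 = 36 * (576 * z^10 - 48 * B * z^8
      - 480 * p3 * z^7 + (B^2 - 48 * D) * z^6 + (20 * B * p3 - 48 * p5) * z^5
      + (2 * B * D + 100 * p3^2) * z^4 + (2 * B * p5 + 20 * p3 * D) * z^3
      + (20 * p3 * p5 + D^2) * z^2 + 2 * D * p5 * z + p5^2) := by
    intro z
    rw [gE6, hB, hD]
    ring
  simp only [key, psE6]
  ring

lemma WE6_2 (a b c d e f t : ℚ) (q : ℕ → ℚ) (hq : q = psE6 a b c d e f) :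
    WE6 a b c d e f t 2 = 2 * t^0 * q 2 + 2 * t^2 * q 0 +
      (1 * q 0 * q 2 + 2 * q 1 * q 1 + 1 * q 2 * q 0 - 4 * q 2) / 2 := by
  rw [hq]
  simp only [WE6, psE6]
  ring

lemma WE6_5 (a b c d e f t : ℚ) (q : ℕ → ℚ) (hq : q = psE6 a b c d e f) :
    WE6 a b c d e f t 5 = -2 * t^0 * q 5 + -20 * t^2 * q 3 + -10 * t^4 * q 1 +
      (1 * q 0 * q 5 + 5 * q 1 * q 4 + 10 * q 2 * q 3 + 10 * q 3 * q 2 + 5 * q 4 * q 1 + 1 * q 5 * q 0 - 32 * q 5) / 2 := by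
  rw [hq]
  simp only [WE6, psE6]
  ring

lemma WE6_6 (a b c d e f t : ℚ) (q : ℕ → ℚ) (hq : q = psE6 a b c d e f) :
    WE6 a b c d e f t 6 = 2 * t^0 * q 6 + 30 * t^2 * q 4 + 30 * t^4 * q 2 + 2 * t^6 * q 0 +
      (1 * q 0 * q 6 + 6 * q 1 * q 5 + 15 * q 2 * q 4 + 20 * q 3 * q 3 + 15 * q 4 * q 2 + 6 * q 5 * q 1 + 1 * q 6 * q 0 - 64 * q 6) / 2 := by
  rw [hq]
  simp only [WE6, psE6]
  ring

lemma WE6_8 (a b c d e f t : ℚ) (q : ℕ → ℚ) (hq : q = psE6 a b c d e f) :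
    WE6 a b c d e f t 8 = 2 * t^0 * q 8 + 56 * t^2 * q 6 + 140 * t^4 * q 4 + 56 * t^6 * q 2 + 2 * t^8 * q 0 +
      (1 * q 0 * q 8 + 8 * q 1 * q 7 + 28 * q 2 * q 6 + 56 * q 3 * q 5 + 70 * q 4 * q 4 + 56 * q 5 * q 3 + 28 * q 6 * q 2 + 8 * q 7 * q 1 + 1 * q 8 * q 0 - 256 * q 8) / 2 := by
  rw [hq]
  simp only [WE6, psE6]
  ring

lemma sum_zero_E6 (a b c d e f : ℚ) (hf : f = -(a + b + c + d + e)) : a + b + c + d + e + f = 0 := by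
  linarith

/-- Newton identities for six numbers with sum zero. -/
lemma newton_E6 (a b c d e f : ℚ) (hs : a + b + c + d + e + f = 0) :
    ∃ e2 e3 e4 e5 e6 : ℚ, psE6 a b c d e f 2 = -2 * e2 ∧ psE6 a b c d e f 3 = 3 * e3 ∧
      psE6 a b c d e f 4 = -e2 * psE6 a b c d e f 2 - 4 * e4 ∧
      psE6 a b c d e f 5 = -e2 * psE6 a b c d e f 3 + e3 * psE6 a b c d e f 2 + 5 * e5 ∧
      ∀ k, psE6 a b c d e f (k + 6) = -e2 * psE6 a b c d e f (k + 4)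
        + e3 * psE6 a b c d e f (k + 3) - e4 * psE6 a b c d e f (k + 2)
        + e5 * psE6 a b c d e f (k + 1) - e6 * psE6 a b c d e f k := by
  obtain rfl : f = -(a + b + c + d + e) := by linarith
  obtain ⟨f, hf⟩ : ∃ f, f = -(a + b + c + d + e) := ⟨_, rfl⟩
  rw [← hf]
  have key : ∀ z, (z - a) * (z - b) * (z - c) * (z - d) * (z - e) * (z - f) =
      z^6 + (a*b + a*c + a*d + a*e + a*f + b*c + b*d + b*e + b*f + c*d + c*e + c*f + d*e + d*f + e*f) * z^4 - (a*b*c + a*b*d + a*b*e + a*b*f + a*c*d + a*c*e + a*c*f + a*d*e + a*d*f + a*e*f + b*c*d + b*c*e + b*c*f + b*d*e + b*d*f + b*e*f + c*d*e + c*d*f + c*e*f + d*e*f) * z^3 +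
      (a*b*c*d + a*b*c*e + a*b*c*f + a*b*d*e + a*b*d*f + a*b*e*f + a*c*d*e + a*c*d*f + a*c*e*f + a*d*e*f + b*c*d*e + b*c*d*f + b*c*e*f + b*d*e*f + c*d*e*f) * z^2 - (a*b*c*d*e + a*b*c*d*f + a*b*c*e*f + a*b*d*e*f + a*c*d*e*f + b*c*d*e*f) * z + (a*b*c*d*e*f) := by
    intro z
    have : (z - a) * (z - b) * (z - c) * (z - d) * (z - e) * (z - f) =
      z^6 - (a + b + c + d + e + f) * z^5 + (a*b + a*c + a*d + a*e + a*f + b*c + b*d + b*e + b*f + c*d + c*e + c*f + d*e + d*f + e*f) * z^4 - (a*b*c + a*b*d + a*b*e + a*b*f + a*c*d + a*c*e + a*c*f + a*d*e + a*d*f + a*e*f + b*c*d + b*c*e + b*c*f + b*d*e + b*d*f + b*e*f + c*d*e + c*d*f + c*e*f + d*e*f) * z^3 +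
      (a*b*c*d + a*b*c*e + a*b*c*f + a*b*d*e + a*b*d*f + a*b*e*f + a*c*d*e + a*c*d*f + a*c*e*f + a*d*e*f + b*c*d*e + b*c*d*f + b*c*e*f + b*d*e*f + c*d*e*f) * z^2 - (a*b*c*d*e + a*b*c*d*f + a*b*c*e*f + a*b*d*e*f + a*c*d*e*f + b*c*d*e*f) * z + (a*b*c*d*e*f) := by ring
    rw [this, sum_zero_E6 a b c d e f hf]
    ring
  refine ⟨(a*b + a*c + a*d + a*e + a*f + b*c + b*d + b*e + b*f + c*d + c*e + c*f + d*e + d*f + e*f), (a*b*c + a*b*d + a*b*e + a*b*f + a*c*d + a*c*e + a*c*f + a*d*e + a*d*f + a*e*f + b*c*d + b*c*e + b*c*f + b*d*e + b*d*f + b*e*f + c*d*e + c*d*f + c*e*f + d*e*f), (a*b*c*d + a*b*c*e + a*b*c*f + a*b*d*e + a*b*d*f + a*b*e*f + a*c*d*e + a*c*d*f + a*c*e*f + a*d*e*f + b*c*d*e + b*c*d*f + b*c*e*f + b*d*e*f + c*d*e*f), (a*b*c*d*e + a*b*c*d*f + a*b*c*e*f + a*b*d*e*f + a*c*d*e*f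 + b*c*d*e*f), (a*b*c*d*e*f), ?_, ?_, ?_, ?_, ?_⟩
  · simp only [psE6]
    rw [hf]
    ring
  · simp only [psE6]
    rw [hf]
    ring
  · simp only [psE6]
    rw [hf]
    ring
  · simp only [psE6]
    rw [hf]
    ring
  · intro k
    have ha := key a
    have hb := key b
    have hc := key c
    have hd := key d
    have he := key e
    have hff := key f
    simp only [sub_self, zero_mul, mul_zero] at ha hb hc hd he hff
    simp only [psE6]
    linear_combination -(a^k * ha + b^k * hb + c^k * hc + d^k * hd + e^k * he + f^k * hff)

/-- The identity, with everything written in power sums. -/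
lemma final_E6 (a b c d e f t : ℚ) (hs : a + b + c + d + e + f = 0) (u2 : ℚ)
    (hu : u2 = 1/12 * WE6 a b c d e f t 2) :
    (6 * (12 * t^5 + 20 * t^3 * psE6 a b c d e f 2 + 10 * t * psE6 a b c d e f 4))^2 +
      2 * (gyE6 a b c d e f t a ^ 2 + gyE6 a b c d e f t b ^ 2 + gyE6 a b c d e f t c ^ 2 + gyE6 a b c d e f t d ^ 2 + gyE6 a b c d e f t e ^ 2 + gyE6 a b c d e f t f ^ 2) -
      (gyE6 a b c d e f t a + gyE6 a b c d e f t b + gyE6 a b c d e f t c + gyE6 a b c d e f t d + gyE6 a b c d e f t e + gyE6 a b c d e f t f)^2 / 3 =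
    144 * WE6 a b c d e f t 8 * u2 + 576 * WE6 a b c d e f t 6 * u2^2 +
      48/5 * WE6 a b c d e f t 5 ^ 2 - 3456 * u2^5 := by
  obtain ⟨e2, e3, e4, e5, e6, h2, h3, h4, h5, hk⟩ := newton_E6 a b c d e f hs
  have h0 : psE6 a b c d e f 0 = 6 := by norm_num [psE6]
  have h1 : psE6 a b c d e f 1 = 0 := by simpa [psE6] using hs
  have h6 := hk 0
  have h7 := hk 1
  have h8 := hk 2
  have h10 := hk 4
  simp only [gyE6]
  rw [sum_gE6, sum_gE6_sq _ _ _ _ _ _ _ _ _ _ _ _ _ rfl rfl, hu,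
    WE6_2 a b c d e f t _ rfl, WE6_5 a b c d e f t _ rfl, WE6_6 a b c d e f t _ rfl,
    WE6_8 a b c d e f t _ rfl]
  clear hu
  generalize psE6 a b c d e f = q at *
  norm_num only at h6 h7 h8 h10
  rw [h2] at h4
  rw [h2, h3] at h5
  rw [h0, h1, h2, h3, h4] at h6
  rw [h1, h2, h3, h4, h5] at h7
  rw [h2, h3, h4, h5, h6] at h8
  rw [h4, h5, h6, h7, h8] at h10
  rw [h0, h1, h2, h3, h4, h5, h6, h7, h8, h10]
  ring

/-- `⟨du₆, du₆⟩* = 144 u₈ u₂ + 576 u₆ u₂² + (48/5) u₅² - 3456 u₂⁵`. -/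
theorem E6_pair_u6_u6 :
    pairE6 (u 6) (u 6) =
      C (144 : ℚ) * u 8 * u 2 + C (576 : ℚ) * u 6 * u 2 ^ 2 +
        C (48/5 : ℚ) * u 5 ^ 2 - C (3456 : ℚ) * u 2 ^ 5 := by
  apply MvPolynomial.funext
  intro y
  have hq := quad_E6 _ _ _ _ _ _ _ (fun i => eval y (pderiv i (u 6))) (eval_pderiv0 y)
    (eval_pderiv1 y) (eval_pderiv2 y) (eval_pderiv3 y) (eval_pderiv4 y) (eval_pderiv5 y)
  have hl : eval y (pairE6 (u 6) (u 6)) = ∑ i : Fin 6, ∑ j : Fin 6,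
      GE6⁻¹ i j * eval y (pderiv i (u 6)) * eval y (pderiv j (u 6)) := by
    simp only [pairE6, map_sum, map_mul, eval_C]
  have hw : ∀ m, eval y (aeval subE6 (U m)) =
      WE6 (y 0) (y 1) (y 2) (y 3) (y 4) (-(y 0 + y 1 + y 2 + y 3 + y 4)) (y 5) m := by
    intro m
    rw [aeval_U, eval_WE6]
    simp
  rw [hl]
  refine hq.trans ?_
  rw [final_E6 _ _ _ _ _ _ _ (by ring) _ rfl]
  simp only [map_sub, map_add, map_mul, map_pow, eval_C, u, if_pos, hw,
    Nat.reduceEqDiff, if_false]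
end
end
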